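/- arXiv:2507.07200 — 3 statements merged into one kernel-verified Lean document; each statement's English description precedes it below -/
import Mathlib

section
/- Let p ≥ 1 and ψ ∈ C_{b,p}(ℝ^d), and for n ∈ ℕ set ψ_n := ψ + (1/n)|·|^p, where |·| is the Euclidean norm. Then the convex hulls conv ψ_n decrease pointwise to conv ψ as n → ∞; moreover conv ψ ∈ C_{b,p}(ℝ^d), and if ψ₁, ψ₂ ∈ C_{b,p}(ℝ^d) with ψ₁ ≤ ψ₂ then conv ψ₁ ≤ conv ψ₂. -/
open MeasureTheory Set Filter Topology
open scoped ENNReal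

noncomputable section

/-- `ℝ^d`, modelled as Euclidean space. -/
abbrev Rd (d : ℕ) : Type := EuclideanSpace ℝ (Fin d)

/-- A Borel measure on `ℝ^d` has finite `p`-th moment. -/
def HasMomentP (p : ℝ) {d : ℕ} (ρ : Measure (Rd d)) : Prop :=
  ∫⁻ y, ENNReal.ofReal (‖y‖ ^ p) ∂ρ ≠ ⊤

/-- `P_p(ℝ^d)`: Borel probability measures on `ℝ^d` with finite `p`-th moment. -/
abbrev Pp (p : ℝ) (d : ℕ) : Type :=
  {ρ : Measure (Rd d) // IsProbabilityMeasure ρ ∧ HasMomentP p ρ}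

/-- Continuous test functions of growth of order at most `p`. -/
def GrowthP (p : ℝ) {d : ℕ} (f : Rd d → ℝ) : Prop :=
  Continuous f ∧ ∃ K : ℝ, ∀ y, |f y| ≤ K * (1 + ‖y‖ ^ p)

/-- The `p`-weak topology on `P_p(ℝ^d)`: the initial topology induced by integration
against continuous functions of growth of order at most `p`. -/
instance PpTopology (p : ℝ) (d : ℕ) : TopologicalSpace (Pp p d) :=
  ⨅ f : {f : Rd d → ℝ // GrowthP p f},
    TopologicalSpace.induced (fun ρ : Pp p d => ∫ y, f.1 y ∂ρ.1) inferInstance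

instance PpMeasurableSpace (p : ℝ) (d : ℕ) : MeasurableSpace (Pp p d) := borel _

/-- `C_{b,p}(ℝ^d)`: continuous functions bounded from below by a constant and bounded
above by `K (1 + |y - y₀|^p)` for some `K > 0`, `y₀`. -/
def Cbp (p : ℝ) {d : ℕ} (ψ : Rd d → ℝ) : Prop :=
  Continuous ψ ∧ (∃ c : ℝ, ∀ y, c ≤ ψ y) ∧
    ∃ K : ℝ, 0 < K ∧ ∃ y₀ : Rd d, ∀ y, ψ y ≤ K * (1 + ‖y - y₀‖ ^ p)

open scoped Classical in
/-- The nonnegative part of an extended real, as an extended nonnegative real. -/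
def erealToENN (x : EReal) : ℝ≥0∞ := if x = ⊤ then ⊤ else ENNReal.ofReal x.toReal

/-- Canonical extended integral of an `EReal`-valued function: the lower integral of the
positive part minus the lower integral of the negative part. -/
def eInt {α : Type*} [MeasurableSpace α] (μ : Measure α) (f : α → EReal) : EReal :=
  ((∫⁻ x, erealToENN (f x) ∂μ : ℝ≥0∞) : EReal) -
    ((∫⁻ x, erealToENN (-(f x)) ∂μ : ℝ≥0∞) : EReal)

/-- The convex order on measures on `ℝ^d`: `ρ₁ ≼_c ρ₂` iff `∫ f dρ₁ ≤ ∫ f dρ₂` for every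
convex function `f : ℝ^d → ℝ` (integrals taken in the extended sense). -/
def ConvexOrder {d : ℕ} (ρ₁ ρ₂ : Measure (Rd d)) : Prop :=
  ∀ f : Rd d → ℝ, ConvexOn ℝ univ f →
    eInt ρ₁ (fun y => (f y : EReal)) ≤ eInt ρ₂ (fun y => (f y : EReal))

/-- Coordinatewise increasing functions on `ℝ^d`. -/
def CoordMono {d : ℕ} (f : Rd d → ℝ) : Prop :=
  ∀ y z : Rd d, (∀ i, y i ≤ z i) → f y ≤ f z

/-- The increasing convex order on measures on `ℝ^d`. -/
def IcxOrder {d : ℕ} (ρ₁ ρ₂ : Measure (Rd d)) : Prop :=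
  ∀ f : Rd d → ℝ, ConvexOn ℝ univ f → CoordMono f →
    eInt ρ₁ (fun y => (f y : EReal)) ≤ eInt ρ₂ (fun y => (f y : EReal))

/-- `π` is a coupling of `μ` and `ν`. -/
def IsCoupling {X Y : Type*} [MeasurableSpace X] [MeasurableSpace Y]
    (π : Measure (X × Y)) (μ : Measure X) (ν : Measure Y) : Prop :=
  IsProbabilityMeasure π ∧ π.map Prod.fst = μ ∧ π.map Prod.snd = ν

open scoped Classical in
/-- Disintegration of a measure on a product space with respect to its first marginal. -/
def disint {X : Type*} [MeasurableSpace X] {Y : Type*} [MeasurableSpace Y]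
    [StandardBorelSpace Y] [Nonempty Y] (π : Measure (X × Y)) :
    ProbabilityTheory.Kernel X Y :=
  if h : IsFiniteMeasure π then (haveI := h; π.condKernel) else 0

/-- The primal weak optimal transport value `inf_{π ∈ Π(μ,ν)} ∫ C(x, π_x) dμ(x)`. -/
def primal {X : Type*} [MeasurableSpace X] {d : ℕ}
    (μ : Measure X) (ν : Measure (Rd d)) (C : X → Measure (Rd d) → ℝ≥0∞) : ℝ≥0∞ :=
  ⨅ π : {π : Measure (X × Rd d) // IsCoupling π μ ν}, ∫⁻ x, C x (disint π.1 x) ∂μ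

/-- The `C`-conjugate `ψ^C (x) = inf_{ρ ∈ P_p} ρ(ψ) + C(x, ρ)`. -/
def conj (p : ℝ) {X : Type*} [MeasurableSpace X] {d : ℕ}
    (C : X → Measure (Rd d) → ℝ≥0∞) (ψ : Rd d → ℝ) (x : X) : EReal :=
  ⨅ ρ : Pp p d, ((∫ y, ψ y ∂ρ.1 : ℝ) : EReal) + ((C x ρ.1 : ℝ≥0∞) : EReal)

/-- The dual value `μ(ψ^C) - ν(ψ)`. -/
def dualVal (p : ℝ) {X : Type*} [MeasurableSpace X] {d : ℕ}
    (μ : Measure X) (ν : Measure (Rd d)) (C : X → Measure (Rd d) → ℝ≥0∞)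
    (ψ : Rd d → ℝ) : EReal :=
  eInt μ (conj p C ψ) - ((∫ y, ψ y ∂ν : ℝ) : EReal)

end

noncomputable section

/-- The convex hull (largest convex minorant) of a function on `ℝ^d`. -/
def convHull {d : ℕ} (ψ : Rd d → ℝ) (y : Rd d) : ℝ :=
  ⨆ φ : {φ : Rd d → ℝ // ConvexOn ℝ Set.univ φ ∧ ∀ z, φ z ≤ ψ z}, φ.1 y

end

section ConvHull

variable {d : ℕ} {ψ : Rd d → ℝ}

lemma bddAbove_convexMinorants (ψ : Rd d → ℝ) (y : Rd d) :
    BddAbove (Set.range fun φ : {φ : Rd d → ℝ // ConvexOn ℝ Set.univ φ ∧ ∀ z, φ z ≤ ψ z} =>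
      φ.1 y) :=
  ⟨ψ y, by rintro _ ⟨φ, rfl⟩; exact φ.2.2 y⟩

lemma le_convHull {φ : Rd d → ℝ} (hφ : ConvexOn ℝ Set.univ φ) (h : ∀ z, φ z ≤ ψ z) (y : Rd d) :
    φ y ≤ convHull ψ y :=
  le_ciSup (bddAbove_convexMinorants ψ y) ⟨φ, hφ, h⟩

lemma nonempty_convexMinorants {c : ℝ} (hc : ∀ z, c ≤ ψ z) :
    Nonempty {φ : Rd d → ℝ // ConvexOn ℝ Set.univ φ ∧ ∀ z, φ z ≤ ψ z} :=
  ⟨⟨fun _ => c, convexOn_const c convex_univ, hc⟩⟩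

lemma convHull_le {c : ℝ} (hc : ∀ z, c ≤ ψ z) (y : Rd d) : convHull ψ y ≤ ψ y :=
  have := nonempty_convexMinorants hc
  ciSup_le fun φ => φ.2.2 y

lemma convexOn_convHull {c : ℝ} (hc : ∀ z, c ≤ ψ z) : ConvexOn ℝ Set.univ (convHull ψ) := by
  have := nonempty_convexMinorants hc
  refine ⟨convex_univ, fun x _ y _ a b ha hb hab => ciSup_le fun φ => ?_⟩
  refine (φ.2.1.2 (Set.mem_univ x) (Set.mem_univ y) ha hb hab).trans ?_
  have hx := le_convHull φ.2.1 φ.2.2 x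
  have hy := le_convHull φ.2.1 φ.2.2 y
  simp only [smul_eq_mul]
  gcongr

lemma convHull_mono {ψ₁ ψ₂ : Rd d → ℝ} {c : ℝ} (hc : ∀ z, c ≤ ψ₁ z) (h : ∀ z, ψ₁ z ≤ ψ₂ z)
    (y : Rd d) : convHull ψ₁ y ≤ convHull ψ₂ y :=
  le_convHull (convexOn_convHull hc) (fun z => (convHull_le hc z).trans (h z)) y

/-- The pointwise limit of convex functions is convex. -/
lemma convexOn_of_tendsto {E ι : Type*} [AddCommGroup E] [Module ℝ E] {l : Filter ι} [l.NeBot]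
    {s : Set E} {f : ι → E → ℝ} {g : E → ℝ} (hs : Convex ℝ s) (hf : ∀ i, ConvexOn ℝ s (f i))
    (h : ∀ x, Filter.Tendsto (fun i => f i x) l (nhds (g x))) : ConvexOn ℝ s g :=
  ⟨hs, fun x hx y hy a b ha hb hab => le_of_tendsto_of_tendsto' (h _)
    (((h x).const_smul a).add ((h y).const_smul b)) fun i => (hf i).2 hx hy ha hb hab⟩

/-- Convex hulls of an antitone sequence with limit bounded below converge pointwise to the convex hull of the limit. -/
lemma tendsto_convHull_of_antitone {f : ℕ → Rd d → ℝ} {c : ℝ} (hc : ∀ z, c ≤ ψ z)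
    (hf : Antitone f) (h : ∀ z, Filter.Tendsto (fun n => f n z) Filter.atTop (nhds (ψ z)))
    (y : Rd d) :
    Filter.Tendsto (fun n => convHull (f n) y) Filter.atTop (nhds (convHull ψ y)) := by
  have hle : ∀ n z, ψ z ≤ f n z := fun n z =>
    Antitone.le_of_tendsto (fun _ _ hmn => hf hmn z) (h z) n
  have hcf : ∀ n z, c ≤ f n z := fun n z => (hc z).trans (hle n z)
  have hge : ∀ n z, convHull ψ z ≤ convHull (f n) z := fun n => convHull_mono hc (hle n)
  have hlim : ∀ z, Filter.Tendsto (fun n => convHull (f n) z) Filter.atTop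
      (nhds (⨅ n, convHull (f n) z)) := fun z =>
    tendsto_atTop_ciInf (fun _ _ hmn => convHull_mono (hcf _) (hf hmn) z)
      ⟨convHull ψ z, by rintro _ ⟨n, rfl⟩; exact hge n z⟩
  have hinf : (⨅ n, convHull (f n) y) ≤ convHull ψ y :=
    le_convHull (φ := fun z => ⨅ n, convHull (f n) z)
      (convexOn_of_tendsto convex_univ (fun n => convexOn_convHull (hcf n)) hlim)
      (fun z => le_of_tendsto_of_tendsto' (hlim z) (h z) fun n => convHull_le (hcf n) z) y
  have heq : (⨅ n, convHull (f n) y) = convHull ψ y :=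
    le_antisymm hinf (le_ciInf fun n => hge n y)
  exact heq ▸ hlim y

lemma Cbp.convHull {p : ℝ} (hψ : Cbp p ψ) : Cbp p (convHull ψ) := by
  obtain ⟨-, ⟨c, hc⟩, K, hK, y₀, hy₀⟩ := hψ
  exact ⟨(convexOn_convHull hc).locallyLipschitz.continuous,
    ⟨c, le_convHull (convexOn_const c convex_univ) hc⟩,
    K, hK, y₀, fun y => (convHull_le hc y).trans (hy₀ y)⟩

end ConvHull

/-- **Properties of the convex hull** (Lemma 2 (iv)-(vi)): for `ψ ∈ C_{b,p}(ℝ^d)` and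
`ψ_n := ψ + (1/n)|·|^p`, the convex hulls `conv ψ_n` decrease pointwise to `conv ψ`;
moreover `conv ψ ∈ C_{b,p}(ℝ^d)`, and the convex hull operator is monotone on
`C_{b,p}(ℝ^d)`. -/
theorem convHull_properties {d : ℕ} {p : ℝ} (hp : 1 ≤ p) (ψ : Rd d → ℝ) (hψ : Cbp p ψ) :
    (∀ y : Rd d, ∀ m n : ℕ, 1 ≤ m → m ≤ n →
        convHull (fun z => ψ z + (1 / (n : ℝ)) * ‖z‖ ^ p) y
          ≤ convHull (fun z => ψ z + (1 / (m : ℝ)) * ‖z‖ ^ p) y)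
      ∧ (∀ y : Rd d,
          Filter.Tendsto (fun n : ℕ => convHull (fun z => ψ z + (1 / (n : ℝ)) * ‖z‖ ^ p) y)
            Filter.atTop (nhds (convHull ψ y)))
      ∧ Cbp p (convHull ψ)
      ∧ (∀ ψ₁ ψ₂ : Rd d → ℝ, Cbp p ψ₁ → Cbp p ψ₂ → (∀ z, ψ₁ z ≤ ψ₂ z) →
          ∀ y, convHull ψ₁ y ≤ convHull ψ₂ y) := by
  obtain ⟨c, hc⟩ := hψ.2.1
  have hnorm : ∀ z : Rd d, 0 ≤ ‖z‖ ^ p := fun z => Real.rpow_nonneg (norm_nonneg z) p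
  have hanti : ∀ m n : ℕ, 1 ≤ m → m ≤ n → ∀ z : Rd d,
      ψ z + (1 / (n : ℝ)) * ‖z‖ ^ p ≤ ψ z + (1 / (m : ℝ)) * ‖z‖ ^ p := by
    intro m n hm hmn z
    have hm' : (0 : ℝ) < m := by exact_mod_cast hm
    have hmn' : (m : ℝ) ≤ n := by exact_mod_cast hmn
    have := one_div_le_one_div_of_le hm' hmn'
    have := hnorm z
    gcongr
  refine ⟨fun y m n hm hmn => convHull_mono (c := c) (fun z => ?_) (hanti m n hm hmn) y,
    fun y => ?_, hψ.convHull, fun ψ₁ ψ₂ h₁ _ h => ?_⟩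
  · have : 0 ≤ (1 / (n : ℝ)) * ‖z‖ ^ p := mul_nonneg (by positivity) (hnorm z)
    linarith [hc z]
  · rw [← Filter.tendsto_add_atTop_iff_nat 1]
    refine tendsto_convHull_of_antitone hc
      (f := fun n z => ψ z + (1 / ((n + 1 : ℕ) : ℝ)) * ‖z‖ ^ p)
      (fun m n hmn => hanti (m + 1) (n + 1) (by lia) (by lia)) (fun z => ?_) y
    have h0 : Filter.Tendsto (fun n : ℕ => 1 / ((n + 1 : ℕ) : ℝ)) Filter.atTop (nhds 0) := by
      simpa using tendsto_one_div_add_atTop_nhds_zero_nat (𝕜 := ℝ)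
    simpa using (h0.mul_const (‖z‖ ^ p)).const_add (ψ z)
  · obtain ⟨c₁, hc₁⟩ := h₁.2.1
    exact convHull_mono hc₁ h
end

section
/- Let X be a Polish space, p ≥ 1, and let C : X × P_p(ℝ^d) → [0,∞] be measurable and decreasing in the increasing convex order in its second argument. Then for every ψ ∈ C_{b,p}(ℝ^d) one has ψ^C = (iconv ψ)^C, i.e. for every x ∈ X, inf_{ρ ∈ P_p(ℝ^d)} ( ∫ψ dρ + C(x,ρ) ) = inf_{ρ ∈ P_p(ℝ^d)} ( ∫ iconv ψ dρ + C(x,ρ) ). -/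
open MeasureTheory Set Filter Topology
open scoped ENNReal

noncomputable section

/-- The increasing convex hull (largest increasing convex minorant) of a function on `ℝ^d`. -/
def iconvHull {d : ℕ} (ψ : Rd d → ℝ) (y : Rd d) : ℝ :=
  ⨆ φ : {φ : Rd d → ℝ // (ConvexOn ℝ Set.univ φ ∧ CoordMono φ) ∧ ∀ z, φ z ≤ ψ z}, φ.1 y

end

section Convexity

variable {d : ℕ}

lemma Convex.lowerEnvelope_convexOn {S : Set (Rd d × ℝ)} (hS : Convex ℝ S)
    (hne : ∀ z, ∃ r, (z, r) ∈ S) {c : ℝ} (hc : ∀ q ∈ S, c ≤ q.2) :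
    ConvexOn ℝ univ fun z => sInf {r : ℝ | (z, r) ∈ S} := by
  have hbdd : ∀ z, BddBelow {r : ℝ | (z, r) ∈ S} := fun z => ⟨c, fun r hr => hc _ hr⟩
  refine ⟨convex_univ, fun z _ z' _ a b ha hb hab => ?_⟩
  refine le_of_forall_pos_le_add fun ε hε => ?_
  obtain ⟨r, hr, hrlt⟩ := exists_lt_of_csInf_lt (s := {r : ℝ | (z, r) ∈ S}) (hne z)
    (lt_add_of_pos_right _ hε)
  obtain ⟨r', hr', hrlt'⟩ := exists_lt_of_csInf_lt (s := {r : ℝ | (z', r) ∈ S}) (hne z')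
    (lt_add_of_pos_right _ hε)
  have hmem : (a • z + b • z', a • r + b • r') ∈ S := hS hr hr' ha hb hab
  refine (csInf_le (hbdd _) hmem).trans ?_
  simp only [smul_eq_mul]
  calc a * r + b * r' ≤ a * (sInf {r : ℝ | (z, r) ∈ S} + ε)
        + b * (sInf {r : ℝ | (z', r) ∈ S} + ε) := by gcongr
    _ = a * sInf {r : ℝ | (z, r) ∈ S} + b * sInf {r : ℝ | (z', r) ∈ S} + (a + b) * ε := by ring
    _ = _ := by rw [hab, one_mul]

lemma ConvexOn.exists_neg_le_linear_growth {f : Rd d → ℝ} (hf : ConvexOn ℝ univ f) :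
    ∃ M : ℝ, 0 ≤ M ∧ ∀ y, -f y ≤ M * (1 + ‖y‖) := by
  obtain ⟨l, c, hl, -⟩ := hf.exists_affine_le_of_lt (𝕜 := ℝ) (x := 0) (a := f 0 - 1) (mem_univ _)
    (by simp) isClosed_univ
    (hf.locallyLipschitz.continuous.lowerSemicontinuous.lowerSemicontinuousOn _)
  refine ⟨‖l‖ + |c|, by positivity, fun y => ?_⟩
  have h1 : l y + c ≤ f y := by simpa using hl ⟨y, mem_univ y⟩
  have h2 : |l y| ≤ ‖l‖ * ‖y‖ := l.le_opNorm y
  nlinarith [neg_abs_le (l y), neg_abs_le c, norm_nonneg l, norm_nonneg y, abs_nonneg c,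
    mul_nonneg (abs_nonneg c) (norm_nonneg y)]

variable {ψ : Rd d → ℝ}

lemma bddAbove_range_increasing_convex_minorants (ψ : Rd d → ℝ) (y : Rd d) :
    BddAbove (range fun φ : {φ : Rd d → ℝ // (ConvexOn ℝ univ φ ∧ CoordMono φ) ∧
      ∀ z, φ z ≤ ψ z} => φ.1 y) :=
  ⟨ψ y, by rintro _ ⟨φ, rfl⟩; exact φ.2.2 y⟩

lemma le_iconvHull {φ : Rd d → ℝ} (hφ : ConvexOn ℝ univ φ) (hm : CoordMono φ)
    (hle : ∀ z, φ z ≤ ψ z) (y : Rd d) : φ y ≤ iconvHull ψ y :=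
  le_ciSup (bddAbove_range_increasing_convex_minorants ψ y) ⟨φ, ⟨hφ, hm⟩, hle⟩

variable {c : ℝ}

lemma nonempty_increasing_convex_minorants (hc : ∀ y, c ≤ ψ y) :
    Nonempty {φ : Rd d → ℝ // (ConvexOn ℝ univ φ ∧ CoordMono φ) ∧ ∀ z, φ z ≤ ψ z} :=
  ⟨⟨fun _ => c, ⟨convexOn_const c convex_univ, fun _ _ _ => le_rfl⟩, hc⟩⟩

lemma const_le_iconvHull (hc : ∀ y, c ≤ ψ y) (y : Rd d) : c ≤ iconvHull ψ y :=
  le_iconvHull (φ := fun _ => c) (convexOn_const c convex_univ) (fun _ _ _ => le_rfl) hc y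

lemma iconvHull_le (hc : ∀ y, c ≤ ψ y) (y : Rd d) : iconvHull ψ y ≤ ψ y :=
  have := nonempty_increasing_convex_minorants hc
  ciSup_le fun φ => φ.2.2 y

lemma convexOn_iconvHull (hc : ∀ y, c ≤ ψ y) : ConvexOn ℝ univ (iconvHull ψ) := by
  have := nonempty_increasing_convex_minorants hc
  refine ⟨convex_univ, fun y _ z _ a b ha hb hab => ciSup_le fun φ => ?_⟩
  refine (φ.2.1.1.2 (mem_univ y) (mem_univ z) ha hb hab).trans ?_
  have hy := le_iconvHull φ.2.1.1 φ.2.1.2 φ.2.2 y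
  have hz := le_iconvHull φ.2.1.1 φ.2.1.2 φ.2.2 z
  simp only [smul_eq_mul]
  gcongr

lemma continuous_iconvHull (hc : ∀ y, c ≤ ψ y) : Continuous (iconvHull ψ) :=
  (convexOn_iconvHull hc).locallyLipschitz.continuous

/-- The increasing convex hull at `z` is approximated by the integrals of `ψ` against finitely
supported probability measures whose barycentre dominates `z`. -/
lemma exists_sum_lt_iconvHull_add (hc : ∀ y, c ≤ ψ y) (z : Rd d) {ε : ℝ} (hε : 0 < ε) :
    ∃ (ι : Type) (_ : Fintype ι) (w : ι → ℝ) (y : ι → Rd d), (∀ i, 0 ≤ w i) ∧ ∑ i, w i = 1 ∧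
      (∀ j, z j ≤ (∑ i, w i • y i) j) ∧ ∑ i, w i * ψ (y i) < iconvHull ψ z + ε := by
  set G : Set (Rd d × ℝ) := convexHull ℝ (range fun y => (y, ψ y))
  have hGc : ∀ q ∈ G, c ≤ q.2 := by
    have hconv : Convex ℝ {q : Rd d × ℝ | c ≤ q.2} :=
      convex_halfSpace_ge (f := fun q : Rd d × ℝ => q.2) ⟨fun _ _ => rfl, fun _ _ => rfl⟩ c
    exact convexHull_min (by rintro _ ⟨y, rfl⟩; exact hc y) hconv
  set S : Set (Rd d × ℝ) := {q | ∃ y, (∀ j, q.1 j ≤ y j) ∧ (y, q.2) ∈ G}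
  have hSconv : Convex ℝ S := by
    rintro ⟨u, r⟩ ⟨y, hy, hyG⟩ ⟨u', r'⟩ ⟨y', hy', hyG'⟩ a b ha hb hab
    refine ⟨a • y + b • y', fun j => ?_, convex_convexHull ℝ _ hyG hyG' ha hb hab⟩
    have := hy j
    have := hy' j
    simp only [Prod.smul_mk, Prod.mk_add_mk, PiLp.add_apply, PiLp.smul_apply, smul_eq_mul] at *
    gcongr
  have hSc : ∀ q ∈ S, c ≤ q.2 := fun q ⟨y, _, hy⟩ => hGc (y, q.2) hy
  have hgraph : ∀ y, (y, ψ y) ∈ S := fun y =>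
    ⟨y, fun _ => le_rfl, subset_convexHull ℝ _ (mem_range_self y)⟩
  have hne : ∀ u, ∃ r, (u, r) ∈ S := fun u => ⟨_, hgraph u⟩
  have hbdd : ∀ u, BddBelow {r : ℝ | (u, r) ∈ S} := fun u => ⟨c, fun r hr => hSc _ hr⟩
  have hle : sInf {r : ℝ | (z, r) ∈ S} ≤ iconvHull ψ z := by
    refine le_iconvHull (φ := fun u => sInf {r : ℝ | (u, r) ∈ S})
      (hSconv.lowerEnvelope_convexOn hne hSc) (fun u v huv => ?_)
      (fun u => csInf_le (hbdd u) (hgraph u)) z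
    refine csInf_le_csInf (hbdd u) (hne v) ?_
    rintro r ⟨y, hy, hyG⟩
    exact ⟨y, fun j => (huv j).trans (hy j), hyG⟩
  obtain ⟨r, ⟨y, hzy, hyG⟩, hr⟩ := exists_lt_of_csInf_lt (s := {r : ℝ | (z, r) ∈ S}) (hne z)
    (hle.trans_lt (lt_add_of_pos_right _ hε))
  obtain ⟨ι, hι, w, q, hw, hw1, hq, hsum⟩ := mem_convexHull_iff_exists_fintype.1 hyG
  choose x hx using hq
  refine ⟨ι, hι, w, x, hw, hw1, fun j => ?_, ?_⟩
  · have h1 := congrArg Prod.fst hsum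
    simp only [← hx, Prod.fst_sum, Prod.smul_mk] at h1
    rw [h1]
    exact hzy j
  · have h2 := congrArg Prod.snd hsum
    simp only [← hx, Prod.snd_sum, Prod.smul_mk, smul_eq_mul] at h2
    rw [h2]
    exact hr

end Convexity

section Moments

variable {d : ℕ} {p : ℝ}

lemma one_add_norm_add_rpow_le (hp : 1 ≤ p) (y v : Rd d) :
    1 + ‖y + v‖ ^ p ≤ (2 ^ p * (1 + ‖v‖ ^ p)) * (1 + ‖y‖ ^ p) := by
  have hp0 : 0 ≤ p := by linarith
  have h1 : (1 : ℝ) ≤ 2 ^ p := Real.one_le_rpow (by norm_num) hp0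
  have hy : 0 ≤ ‖y‖ ^ p := by positivity
  have hv : 0 ≤ ‖v‖ ^ p := by positivity
  have h2 : ‖y + v‖ ^ p ≤ 2 ^ p * (‖y‖ ^ p + ‖v‖ ^ p) := by
    have hle : ‖y + v‖ ≤ 2 * max ‖y‖ ‖v‖ := by
      linarith [norm_add_le y v, le_max_left ‖y‖ ‖v‖, le_max_right ‖y‖ ‖v‖]
    have hmax : (max ‖y‖ ‖v‖) ^ p ≤ ‖y‖ ^ p + ‖v‖ ^ p := by
      rcases max_cases ‖y‖ ‖v‖ with ⟨h, -⟩ | ⟨h, -⟩ <;> rw [h] <;> linarith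
    calc ‖y + v‖ ^ p ≤ (2 * max ‖y‖ ‖v‖) ^ p := by gcongr
      _ = 2 ^ p * (max ‖y‖ ‖v‖) ^ p := Real.mul_rpow (by norm_num) (by positivity)
      _ ≤ _ := by gcongr
  nlinarith [mul_nonneg (zero_le_one.trans h1) (mul_nonneg hy hv)]

lemma one_add_norm_le (hp : 1 ≤ p) (y : Rd d) : 1 + ‖y‖ ≤ 2 * (1 + ‖y‖ ^ p) := by
  have hy : 0 ≤ ‖y‖ ^ p := by positivity
  rcases le_total 1 ‖y‖ with h | h
  · linarith [Real.self_le_rpow_of_one_le h hp]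
  · linarith

lemma HasMomentP.lintegral_ne_top {ρ : Measure (Rd d)} [IsFiniteMeasure ρ] (hρ : HasMomentP p ρ)
    {f : Rd d → ℝ} {K : ℝ} (hf : ∀ y, f y ≤ K * (1 + ‖y‖ ^ p)) :
    ∫⁻ y, ENNReal.ofReal (f y) ∂ρ ≠ ⊤ := by
  have hle : ∀ y, ENNReal.ofReal (f y)
      ≤ ENNReal.ofReal |K| * (1 + ENNReal.ofReal (‖y‖ ^ p)) := fun y => by
    have hy : 0 ≤ ‖y‖ ^ p := by positivity
    rw [← ENNReal.ofReal_one, ← ENNReal.ofReal_add zero_le_one hy,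
      ← ENNReal.ofReal_mul (abs_nonneg K)]
    refine ENNReal.ofReal_le_ofReal ((hf y).trans ?_)
    gcongr
    exact le_abs_self K
  refine ne_top_of_le_ne_top ?_ (lintegral_mono hle)
  rw [lintegral_const_mul' _ _ ENNReal.ofReal_ne_top, lintegral_add_left measurable_const]
  exact ENNReal.mul_ne_top ENNReal.ofReal_ne_top
    (ENNReal.add_ne_top.2 ⟨by simp, hρ⟩)

lemma HasMomentP.mono {ρ σ : Measure (Rd d)} (hρ : HasMomentP p ρ) (h : σ ≤ ρ) :
    HasMomentP p σ :=
  ne_top_of_le_ne_top hρ (lintegral_mono' h le_rfl)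

end Moments

section Domination

variable {d : ℕ} {p : ℝ}

lemma eInt_coe (μ : Measure (Rd d)) (f : Rd d → ℝ) :
    eInt μ (fun y => (f y : EReal)) =
      ((∫⁻ y, ENNReal.ofReal (f y) ∂μ : ℝ≥0∞) : EReal) -
        ((∫⁻ y, ENNReal.ofReal (-f y) ∂μ : ℝ≥0∞) : EReal) := by
  simp [eInt, erealToENN, ← EReal.coe_neg]

lemma EReal.coe_ennreal_sub_le_sub {a b a' b' : ℝ≥0∞} (hb : b ≠ ⊤) (hb' : b' ≠ ⊤)
    (h : a + b' ≤ a' + b) : (a : EReal) - b ≤ (a' : EReal) - b' := by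
  lift b to NNReal using hb
  lift b' to NNReal using hb'
  rcases eq_or_ne a' ⊤ with rfl | ha'
  · have : ((⊤ : ℝ≥0∞) : EReal) - ((b' : ℝ≥0∞) : EReal) = ⊤ := by
      simp
    rw [this]
    exact le_top
  lift a' to NNReal using ha'
  have ha : a ≠ ⊤ := by
    rintro rfl
    simp at h
  lift a to NNReal using ha
  have h' : (a : ℝ) + b' ≤ a' + b := by exact_mod_cast h
  have h2 : (a : ℝ) - b ≤ a' - b' := by linarith
  exact EReal.coe_le_coe_iff.2 h2

/-- `σ` has the mass of `μ` and a finite `p`-th moment, and dominates `μ` in the increasing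
convex order; the order is expressed through positive and negative parts. -/
structure IcxDominates (p : ℝ) {d : ℕ} (μ σ : Measure (Rd d)) : Prop where
  mass : σ univ = μ univ
  moment : HasMomentP p σ
  icx : ∀ f : Rd d → ℝ, ConvexOn ℝ univ f → CoordMono f →
    ∫⁻ y, ENNReal.ofReal (f y) ∂μ + ∫⁻ y, ENNReal.ofReal (-f y) ∂σ ≤
      ∫⁻ y, ENNReal.ofReal (f y) ∂σ + ∫⁻ y, ENNReal.ofReal (-f y) ∂μ

namespace IcxDominates

lemma refl {μ : Measure (Rd d)} (h : HasMomentP p μ) : IcxDominates p μ μ :=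
  ⟨rfl, h, fun _ _ _ => le_rfl⟩

lemma add {μ₁ μ₂ σ₁ σ₂ : Measure (Rd d)} (h₁ : IcxDominates p μ₁ σ₁)
    (h₂ : IcxDominates p μ₂ σ₂) : IcxDominates p (μ₁ + μ₂) (σ₁ + σ₂) where
  mass := by simp [h₁.mass, h₂.mass]
  moment := by
    rw [HasMomentP, lintegral_add_measure]
    exact ENNReal.add_ne_top.2 ⟨h₁.moment, h₂.moment⟩
  icx f hf hm := by
    simp only [lintegral_add_measure]
    calc _ = (∫⁻ y, ENNReal.ofReal (f y) ∂μ₁ + ∫⁻ y, ENNReal.ofReal (-f y) ∂σ₁) +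
          (∫⁻ y, ENNReal.ofReal (f y) ∂μ₂ + ∫⁻ y, ENNReal.ofReal (-f y) ∂σ₂) := by abel
      _ ≤ _ := add_le_add (h₁.icx f hf hm) (h₂.icx f hf hm)
      _ = _ := by abel

lemma icxOrder (hp : 1 ≤ p) {μ σ : Measure (Rd d)} [IsFiniteMeasure μ] [IsFiniteMeasure σ]
    (hμ : HasMomentP p μ) (h : IcxDominates p μ σ) : IcxOrder μ σ := by
  intro f hf hm
  obtain ⟨M, hM, hle⟩ := hf.exists_neg_le_linear_growth
  have hgrow : ∀ y, -f y ≤ (M * 2) * (1 + ‖y‖ ^ p) := fun y => by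
    rw [mul_assoc]
    exact (hle y).trans (mul_le_mul_of_nonneg_left (one_add_norm_le hp y) hM)
  rw [eInt_coe, eInt_coe]
  exact EReal.coe_ennreal_sub_le_sub (hμ.lintegral_ne_top hgrow)
    (h.moment.lintegral_ne_top hgrow) (h.icx f hf hm)

end IcxDominates

/-- Each point of mass of `μ` at `y` is spread over the points `y + v i` with weights `w i`. -/
noncomputable def spread {ι : Type} [Fintype ι] (w : ι → ℝ) (v : ι → Rd d) (μ : Measure (Rd d)) :
    Measure (Rd d) :=
  ∑ i, ENNReal.ofReal (w i) • μ.map (· + v i)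

section Spread

variable {ι : Type} [Fintype ι] {w : ι → ℝ} {v : ι → Rd d}

lemma lintegral_spread (w : ι → ℝ) (v : ι → Rd d) (μ : Measure (Rd d)) {g : Rd d → ℝ≥0∞}
    (hg : Measurable g) :
    ∫⁻ y, g y ∂(spread w v μ) = ∫⁻ y, ∑ i, ENNReal.ofReal (w i) * g (y + v i) ∂μ := by
  rw [spread, lintegral_finsetSum_measure, lintegral_finsetSum _ (fun i _ => by fun_prop)]
  refine Finset.sum_congr rfl fun i _ => ?_
  rw [lintegral_smul_measure, lintegral_map hg (by fun_prop), lintegral_const_mul _ (by fun_prop),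
    smul_eq_mul]

lemma le_sum_of_convexOn_of_coordMono {f : Rd d → ℝ} (hf : ConvexOn ℝ univ f) (hm : CoordMono f)
    (hw : ∀ i, 0 ≤ w i) (hw1 : ∑ i, w i = 1) (hv : ∀ j, 0 ≤ (∑ i, w i • v i) j) (y : Rd d) :
    f y ≤ ∑ i, w i * f (y + v i) := by
  have hsum : ∑ i, w i • (y + v i) = y + ∑ i, w i • v i := by
    simp only [smul_add, Finset.sum_add_distrib, ← Finset.sum_smul, hw1, one_smul]
  calc f y ≤ f (y + ∑ i, w i • v i) := hm _ _ fun j => by simpa using hv j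
    _ = f (∑ i, w i • (y + v i)) := by rw [hsum]
    _ ≤ _ := hf.map_sum_le (fun i _ => hw i) hw1 (fun i _ => mem_univ _)

lemma ofReal_add_sum_ofReal_neg_le {a : ℝ} {b : ι → ℝ} (hw : ∀ i, 0 ≤ w i)
    (h : a ≤ ∑ i, w i * b i) :
    ENNReal.ofReal a + ∑ i, ENNReal.ofReal (w i) * ENNReal.ofReal (-b i) ≤
      ∑ i, ENNReal.ofReal (w i) * ENNReal.ofReal (b i) + ENNReal.ofReal (-a) := by
  have key : ∀ b : ι → ℝ, ∑ i, ENNReal.ofReal (w i) * ENNReal.ofReal (b i) =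
      ENNReal.ofReal (∑ i, w i * max (b i) 0) := fun b => by
    rw [ENNReal.ofReal_sum_of_nonneg fun i _ => mul_nonneg (hw i) (le_max_right _ _)]
    refine Finset.sum_congr rfl fun i _ => ?_
    rw [ENNReal.ofReal_mul (hw i), ENNReal.ofReal_max, ENNReal.ofReal_zero, max_eq_left zero_le]
  have hnn : ∀ b : ι → ℝ, 0 ≤ ∑ i, w i * max (b i) 0 := fun b =>
    Finset.sum_nonneg fun i _ => mul_nonneg (hw i) (le_max_right _ _)
  have hmax : ∀ a : ℝ, ENNReal.ofReal a = ENNReal.ofReal (max a 0) := fun a => by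
    simp [ENNReal.ofReal_max]
  have hdiff : ∑ i, w i * max (b i) 0 - ∑ i, w i * max (-b i) 0 = ∑ i, w i * b i := by
    rw [← Finset.sum_sub_distrib]
    refine Finset.sum_congr rfl fun i _ => ?_
    rw [← mul_sub, max_zero_sub_max_neg_zero_eq_self]
  have ha : max a 0 - max (-a) 0 = a := max_zero_sub_max_neg_zero_eq_self a
  rw [key, key, hmax a, hmax (-a), ← ENNReal.ofReal_add (le_max_right _ _) (hnn _),
    ← ENNReal.ofReal_add (hnn _) (le_max_right _ _)]
  exact ENNReal.ofReal_le_ofReal (by linarith)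

lemma icxDominates_spread (hp : 1 ≤ p) {μ : Measure (Rd d)} [IsFiniteMeasure μ]
    (hμ : HasMomentP p μ) (hw : ∀ i, 0 ≤ w i) (hw1 : ∑ i, w i = 1)
    (hv : ∀ j, 0 ≤ (∑ i, w i • v i) j) : IcxDominates p μ (spread w v μ) where
  mass := by
    have := lintegral_spread w v μ (g := fun _ => 1) measurable_const
    simpa [← ENNReal.ofReal_sum_of_nonneg fun i _ => hw i, hw1] using this
  moment := by
    rw [HasMomentP, lintegral_spread w v μ (by fun_prop),
      lintegral_finsetSum _ (fun i _ => by fun_prop)]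
    refine ENNReal.sum_ne_top.2 fun i _ => ?_
    rw [lintegral_const_mul _ (by fun_prop)]
    refine ENNReal.mul_ne_top ENNReal.ofReal_ne_top
      (hμ.lintegral_ne_top (K := 2 ^ p * (1 + ‖v i‖ ^ p)) fun y => ?_)
    linarith [one_add_norm_add_rpow_le hp y (v i)]
  icx f hf hm := by
    have hfc := hf.locallyLipschitz.continuous
    rw [lintegral_spread w v μ (by fun_prop), lintegral_spread w v μ (by fun_prop),
      ← lintegral_add_left (by fun_prop), ← lintegral_add_right _ (by fun_prop)]
    exact lintegral_mono fun y =>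
      ofReal_add_sum_ofReal_neg_le hw (le_sum_of_convexOn_of_coordMono hf hm hw hw1 hv y)

end Spread

end Domination

section Approximation

variable {d : ℕ} {p c : ℝ} {ψ : Rd d → ℝ}

/-- On sets near `z`, a measure is dominated by one whose `ψ`-integral almost realises the
integral of the increasing convex hull. -/
lemma exists_isOpen_forall_subset_icxDominates (hp : 1 ≤ p) (hψ : Continuous ψ)
    (hc : ∀ y, c ≤ ψ y) {ρ : Measure (Rd d)} [IsFiniteMeasure ρ] (hρ : HasMomentP p ρ) {ε : ℝ}
    (hε : 0 < ε) (z : Rd d) :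
    ∃ U, IsOpen U ∧ z ∈ U ∧ ∀ A ⊆ U, MeasurableSet A → ∃ σ, IcxDominates p (ρ.restrict A) σ ∧
      ∫⁻ y, ENNReal.ofReal (ψ y - c) ∂σ ≤
        ∫⁻ y in A, ENNReal.ofReal (iconvHull ψ y - c + ε) ∂ρ := by
  obtain ⟨ι, _, w, y, hw, hw1, hz, hlt⟩ := exists_sum_lt_iconvHull_add hc z hε
  have hφ := continuous_iconvHull hc
  refine ⟨{u | ∑ i, w i * ψ (u + (y i - z)) < iconvHull ψ u + ε},
    isOpen_lt (by fun_prop) (by fun_prop), by simpa using hlt, fun A hA hAm => ?_⟩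
  refine ⟨spread w (fun i => y i - z) (ρ.restrict A),
    icxDominates_spread hp (hρ.mono Measure.restrict_le_self) hw hw1 fun j => ?_, ?_⟩
  · have : ∑ i, w i • (y i - z) = ∑ i, w i • y i - z := by
      simp only [smul_sub, Finset.sum_sub_distrib, ← Finset.sum_smul, hw1, one_smul]
    rw [this, PiLp.sub_apply]
    linarith [hz j]
  · rw [lintegral_spread _ _ _ (by fun_prop)]
    refine setLIntegral_mono' hAm fun u hu => ?_
    simp only [← ENNReal.ofReal_mul (hw _)]
    rw [← ENNReal.ofReal_sum_of_nonneg fun i _ => mul_nonneg (hw i) (sub_nonneg.2 (hc _))]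
    refine ENNReal.ofReal_le_ofReal ?_
    have h1 := hA hu
    simp only [mem_ofPred_eq] at h1
    simp only [mul_sub, Finset.sum_sub_distrib, ← Finset.sum_mul, hw1, one_mul] at h1 ⊢
    linarith

lemma IsCompact.exists_superset_icxDominates (hp : 1 ≤ p) (hψ : Continuous ψ)
    (hc : ∀ y, c ≤ ψ y) {ρ : Measure (Rd d)} [IsFiniteMeasure ρ] (hρ : HasMomentP p ρ) {ε : ℝ}
    (hε : 0 < ε) {K : Set (Rd d)} (hK : IsCompact K) :
    ∃ T, K ⊆ T ∧ MeasurableSet T ∧ ∀ A ⊆ T, MeasurableSet A →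
      ∃ σ, IcxDominates p (ρ.restrict A) σ ∧ ∫⁻ y, ENNReal.ofReal (ψ y - c) ∂σ ≤
        ∫⁻ y in A, ENNReal.ofReal (iconvHull ψ y - c + ε) ∂ρ := by
  refine hK.induction_on ?_ (fun _ _ hst ih => ?_) (fun _ _ ih₁ ih₂ => ?_) fun z _ => ?_
  · refine ⟨∅, Subset.rfl, MeasurableSet.empty, fun A hA _ => ?_⟩
    obtain rfl := subset_empty_iff.1 hA
    exact ⟨0, by simpa using IcxDominates.refl (by simp [HasMomentP]), by simp⟩
  · obtain ⟨T, hT, h⟩ := ih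
    exact ⟨T, hst.trans hT, h⟩
  · obtain ⟨T₁, hKT₁, hT₁, h₁⟩ := ih₁
    obtain ⟨T₂, hKT₂, hT₂, h₂⟩ := ih₂
    refine ⟨T₁ ∪ T₂, union_subset_union hKT₁ hKT₂, hT₁.union hT₂, fun A hA hAm => ?_⟩
    obtain ⟨σ₁, hσ₁, hle₁⟩ := h₁ (A ∩ T₁) inter_subset_right (hAm.inter hT₁)
    obtain ⟨σ₂, hσ₂, hle₂⟩ := h₂ (A \ T₁) (fun u hu => (hA hu.1).resolve_left hu.2)
      (hAm.diff hT₁)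
    refine ⟨σ₁ + σ₂, ?_, ?_⟩
    · rw [← Measure.restrict_inter_add_sdiff A hT₁]
      exact hσ₁.add hσ₂
    · rw [lintegral_add_measure, ← lintegral_inter_add_sdiff _ A hT₁]
      exact add_le_add hle₁ hle₂
  · obtain ⟨U, hU, hzU, h⟩ := exists_isOpen_forall_subset_icxDominates hp hψ hc hρ hε z
    exact ⟨U, mem_nhdsWithin_of_mem_nhds (hU.mem_nhds hzU), U, Subset.rfl, hU.measurableSet, h⟩

lemma exists_icxDominates_lintegral_le (hp : 1 ≤ p) (hψ : Continuous ψ) (hc : ∀ y, c ≤ ψ y)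
    {ρ : Measure (Rd d)} [IsProbabilityMeasure ρ] (hρ : HasMomentP p ρ)
    (hfin : ∫⁻ y, ENNReal.ofReal (ψ y - c) ∂ρ ≠ ⊤) {ε : ℝ} (hε : 0 < ε) :
    ∃ σ, IcxDominates p ρ σ ∧ ∫⁻ y, ENNReal.ofReal (ψ y - c) ∂σ ≤
      ∫⁻ y, ENNReal.ofReal (iconvHull ψ y - c) ∂ρ + ENNReal.ofReal (2 * ε) := by
  have hφ := continuous_iconvHull hc
  have hfinite : IsFiniteMeasure (ρ.withDensity fun y => ENNReal.ofReal (ψ y - c)) :=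
    isFiniteMeasure_withDensity hfin
  obtain ⟨K, -, hK, hKlt⟩ := MeasurableSet.univ.exists_isCompact_sdiff_lt
    (μ := ρ.withDensity fun y => ENNReal.ofReal (ψ y - c)) (measure_ne_top _ _)
    (ε := ENNReal.ofReal ε) (by simpa using hε)
  obtain ⟨T, hKT, hT, h⟩ := hK.exists_superset_icxDominates hp hψ hc hρ hε
  obtain ⟨σ, hσ, hle⟩ := h T Subset.rfl hT
  refine ⟨σ + ρ.restrict Tᶜ, ?_, ?_⟩
  · have := hσ.add (IcxDominates.refl (hρ.mono (Measure.restrict_le_self (s := Tᶜ))))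
    rwa [Measure.restrict_add_restrict_compl hT] at this
  · have htail : ∫⁻ y in Tᶜ, ENNReal.ofReal (ψ y - c) ∂ρ ≤ ENNReal.ofReal ε := by
      rw [← withDensity_apply _ hT.compl]
      refine (measure_mono ?_).trans hKlt.le
      rw [← compl_eq_univ_sdiff]
      exact compl_subset_compl.2 hKT
    have hmain : ∫⁻ y in T, ENNReal.ofReal (iconvHull ψ y - c + ε) ∂ρ ≤
        ∫⁻ y, ENNReal.ofReal (iconvHull ψ y - c) ∂ρ + ENNReal.ofReal ε := by
      refine (setLIntegral_le_lintegral T _).trans ?_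
      refine (lintegral_mono fun y => ENNReal.ofReal_add_le).trans ?_
      rw [lintegral_add_right _ measurable_const]
      simp
    rw [lintegral_add_measure, two_mul, ENNReal.ofReal_add hε.le hε.le, ← add_assoc]
    exact add_le_add (hle.trans hmain) htail

lemma Cbp.exists_growth (hp : 1 ≤ p) (hψ : Cbp p ψ) :
    ∃ K : ℝ, 0 ≤ K ∧ ∀ y, ψ y ≤ K * (1 + ‖y‖ ^ p) := by
  obtain ⟨-, -, K, hK, y₀, h⟩ := hψ
  refine ⟨K * (2 ^ p * (1 + ‖-y₀‖ ^ p)), by positivity, fun y => (h y).trans ?_⟩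
  rw [mul_assoc, sub_eq_add_neg]
  exact mul_le_mul_of_nonneg_left (one_add_norm_add_rpow_le hp y (-y₀)) hK.le

lemma HasMomentP.integrable {ρ : Measure (Rd d)} [IsFiniteMeasure ρ] (hρ : HasMomentP p ρ)
    {f : Rd d → ℝ} (hf : Continuous f) {K : ℝ} (hK : 0 ≤ K) (hc : ∀ y, c ≤ f y)
    (hle : ∀ y, f y ≤ K * (1 + ‖y‖ ^ p)) : Integrable f ρ := by
  refine ⟨hf.aestronglyMeasurable, ?_⟩
  rw [hasFiniteIntegral_iff_norm]
  refine (hρ.lintegral_ne_top (K := K + |c|) fun y => ?_).lt_top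
  have hy : 0 ≤ ‖y‖ ^ p := by positivity
  rw [Real.norm_eq_abs, abs_le]
  constructor <;> nlinarith [hle y, hc y, neg_abs_le c, abs_nonneg c, mul_nonneg (abs_nonneg c) hy,
    mul_nonneg hK hy]

lemma lintegral_ofReal_sub_const {ρ : Measure (Rd d)} [IsProbabilityMeasure ρ] {f : Rd d → ℝ}
    (hf : Integrable f ρ) (hc : ∀ y, c ≤ f y) :
    ∫⁻ y, ENNReal.ofReal (f y - c) ∂ρ = ENNReal.ofReal (∫ y, f y ∂ρ - c) := by
  have h := ofReal_integral_eq_lintegral_ofReal (hf.sub (integrable_const c))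
    (Eventually.of_forall fun y => sub_nonneg.2 (hc y))
  simp only [Pi.sub_apply, integral_sub hf (integrable_const c)] at h
  simpa using h.symm

lemma exists_icxOrder_integral_le (hp : 1 ≤ p) (hψ : Cbp p ψ) (ρ : Pp p d) {ε : ℝ} (hε : 0 < ε) :
    ∃ σ : Pp p d, IcxOrder ρ.1 σ.1 ∧ ∫ y, ψ y ∂σ.1 ≤ ∫ y, iconvHull ψ y ∂ρ.1 + ε := by
  obtain ⟨ρ, hprob, hρ⟩ := ρ
  obtain ⟨K, hK, hle⟩ := hψ.exists_growth hp
  obtain ⟨hcont, ⟨c, hc⟩, -⟩ := hψ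
  have hψρ : Integrable ψ ρ := hρ.integrable hcont hK hc hle
  have hφρ : Integrable (iconvHull ψ) ρ := hρ.integrable (continuous_iconvHull hc) hK
    (const_le_iconvHull hc) fun y => (iconvHull_le hc y).trans (hle y)
  obtain ⟨σ, hσ, hσle⟩ := exists_icxDominates_lintegral_le hp hcont hc hρ
    (by rw [lintegral_ofReal_sub_const hψρ hc]; exact ENNReal.ofReal_ne_top) (half_pos hε)
  have hσprob : IsProbabilityMeasure σ := ⟨by rw [hσ.mass, measure_univ]⟩
  refine ⟨⟨σ, hσprob, hσ.moment⟩, hσ.icxOrder hp hρ, ?_⟩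
  have hφc : 0 ≤ ∫ y, iconvHull ψ y ∂ρ - c := by
    have := integral_mono (integrable_const c) hφρ (const_le_iconvHull hc)
    simpa using this
  rw [lintegral_ofReal_sub_const (hσ.moment.integrable hcont hK hc hle) hc,
    lintegral_ofReal_sub_const hφρ (const_le_iconvHull hc), ← ENNReal.ofReal_add hφc (by linarith),
    ENNReal.ofReal_le_ofReal_iff (by linarith)] at hσle
  linarith

end Approximation

/-- **Stability of the `C`-conjugate under taking increasing convex hulls** (Lemma 3,
increasing convex case): if `C` is measurable and `≼_icx`-decreasing in its second
argument, then `ψ^C = (iconv ψ)^C` for every `ψ ∈ C_{b,p}(ℝ^d)`. -/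
theorem conj_iconvHull_eq
    {X : Type*} [TopologicalSpace X] [PolishSpace X] [MeasurableSpace X] [BorelSpace X]
    {d : ℕ} {p : ℝ} (hp : 1 ≤ p)
    (C : X → Measure (Rd d) → ℝ≥0∞)
    (hmeas : Measurable fun q : X × Pp p d => C q.1 q.2.1)
    (hmono : ∀ x : X, ∀ ρ₁ ρ₂ : Pp p d, IcxOrder ρ₁.1 ρ₂.1 → C x ρ₂.1 ≤ C x ρ₁.1)
    (ψ : Rd d → ℝ) (hψ : Cbp p ψ) (x : X) :
    conj p C ψ x = conj p C (iconvHull ψ) x := by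
  refine le_antisymm (le_iInf fun ρ => ?_) (iInf_mono fun ρ => ?_)
  · have key : ∀ ε : ℝ, 0 < ε → conj p C ψ x ≤
        ((∫ y, iconvHull ψ y ∂ρ.1 + ε : ℝ) : EReal) + ((C x ρ.1 : ℝ≥0∞) : EReal) := fun ε hε => by
      obtain ⟨σ, hσ, hle⟩ := exists_icxOrder_integral_le hp hψ ρ hε
      refine (iInf_le _ σ).trans (add_le_add (EReal.coe_le_coe_iff.2 hle) ?_)
      exact EReal.coe_ennreal_le_coe_ennreal_iff.2 (hmono x ρ σ hσ)
    rcases eq_or_ne (C x ρ.1) ⊤ with hC | hC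
    · simp [hC]
    lift C x ρ.1 to NNReal using hC with b
    refine EReal.le_of_forall_lt_iff_le.1 fun r hr => ?_
    have hr' : ∫ y, iconvHull ψ y ∂ρ.1 + (b : ℝ) < r := EReal.coe_lt_coe_iff.1 hr
    refine (key (r - (∫ y, iconvHull ψ y ∂ρ.1 + (b : ℝ))) (by linarith)).trans
      (EReal.coe_le_coe_iff.2 ?_ : ((_ + (b : ℝ) : ℝ) : EReal) ≤ _)
    linarith
  · obtain ⟨ρ, hprob, hρ⟩ := ρ
    obtain ⟨K, hK, hle⟩ := hψ.exists_growth hp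
    obtain ⟨hcont, ⟨c, hc⟩, -⟩ := hψ
    refine add_le_add (EReal.coe_le_coe_iff.2 ?_) le_rfl
    exact integral_mono (hρ.integrable (continuous_iconvHull hc) hK (const_le_iconvHull hc)
      fun y => (iconvHull_le hc y).trans (hle y)) (hρ.integrable hcont hK hc hle) (iconvHull_le hc)
end

section
/- (Strassen's theorem for submartingales) Let μ, ν ∈ P₁(ℝ^d). Then μ ≼_icx ν if and only if there exists a submartingale coupling between μ and ν, that is, a coupling π ∈ Π(μ,ν) such that x ≤ ∫_{ℝ^d} y dπ_x(y) coordinatewise for μ-almost every x ∈ ℝ^d. -/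
open MeasureTheory Set Filter Topology
open scoped ENNReal

/-- Continuous functions dominated by a multiple of the weight `W`. -/
def growthSubmodule {X : Type*} [TopologicalSpace X] (W : X → ℝ) : Submodule ℝ (X → ℝ) where
  carrier := {g | Continuous g ∧ ∃ K : ℝ, ∀ z, |g z| ≤ K * W z}
  add_mem' := by
    rintro f g ⟨hf, K, hK⟩ ⟨hg, M, hM⟩
    refine ⟨hf.add hg, K + M, fun z => ?_⟩
    have := abs_add_le (f z) (g z)
    simp only [Pi.add_apply, add_mul]
    linarith [hK z, hM z]
  zero_mem' := ⟨continuous_zero, 0, fun z => by simp⟩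
  smul_mem' := by
    rintro c f ⟨hf, K, hK⟩
    refine ⟨hf.const_smul c, |c| * K, fun z => ?_⟩
    simp only [Pi.smul_apply, smul_eq_mul, abs_mul, mul_assoc]
    exact mul_le_mul_of_nonneg_left (hK z) (abs_nonneg c)

open CompactlySupported in
/-- A positive functional on continuous functions dominated by a weight with compact sublevel
sets is integration against a measure as soon as it is tight. -/
theorem exists_measure_of_tight_positive_functional {X : Type*} [TopologicalSpace X] [T2Space X]
    [LocallyCompactSpace X] [MeasurableSpace X] [BorelSpace X] {W : X → ℝ}
    (hW1 : ∀ z, 1 ≤ W z) (hWc : ∀ c, IsCompact {z | W z ≤ c})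
    (L : growthSubmodule W →ₗ[ℝ] ℝ) (hL : ∀ g, (∀ z, 0 ≤ g.1 z) → 0 ≤ L g)
    (T : ℕ → growthSubmodule W) (hT : ∀ n z, (T n).1 z = max (W z - n) 0)
    (hTlim : Tendsto (fun n => L (T n)) atTop (𝓝 0)) :
    ∃ π : Measure X, ∀ g : growthSubmodule W,
      Integrable g.1 π ∧ ∫ z, g.1 z ∂π = L g := by
  have hLmono : ∀ g h : growthSubmodule W, (∀ z, g.1 z ≤ h.1 z) → L g ≤ L h := by
    intro g h hgh
    have := hL (h - g) fun z => sub_nonneg.2 (hgh z)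
    rw [map_sub] at this
    linarith
  let j : C_c(X, ℝ) →ₗ[ℝ] growthSubmodule W :=
    { toFun := fun f => ⟨f, f.continuous, by
        obtain ⟨C, hC⟩ := f.hasCompactSupport.exists_bound_of_continuous f.continuous
        refine ⟨|C|, fun z => ?_⟩
        have h1 : |f z| ≤ |C| := (hC z).trans (le_abs_self C)
        nlinarith [hW1 z, abs_nonneg C]⟩
      map_add' := fun f g => rfl
      map_smul' := fun c f => rfl }
  let Λ : C_c(X, ℝ) →ₚ[ℝ] ℝ := PositiveLinearMap.mk₀ (L ∘ₗ j) fun f hf => hL _ fun z => hf z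
  let π := RealRMK.rieszMeasure Λ
  have hΛ : ∀ f : C_c(X, ℝ), ∫ x, f x ∂π = L (j f) := RealRMK.integral_rieszMeasure Λ
  have key : ∀ g : growthSubmodule W, (∀ z, 0 ≤ g.1 z) →
      ∫⁻ z, ENNReal.ofReal (g.1 z) ∂π = ENNReal.ofReal (L g) := by
    intro g hg
    obtain ⟨hgc, K, hK⟩ := g.2
    have hK0 : ∀ _ : X, 0 ≤ K := fun z => by
      by_contra h
      nlinarith [hK z, abs_nonneg (g.1 z), hW1 z]
    have hcs : ∀ n : ℕ, HasCompactSupport fun z => max (g.1 z - 2 * K * (T n).1 z) 0 := by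
      intro n
      refine HasCompactSupport.intro (hWc (2 * n)) fun z hz => ?_
      have hz' : 2 * (n : ℝ) < W z := not_le.1 hz
      have h1 : W z - n ≤ (T n).1 z := by rw [hT]; exact le_max_left _ _
      have h2 := (abs_le.1 (hK z)).2
      have h3 : K * W z ≤ K * (2 * (W z - n)) :=
        mul_le_mul_of_nonneg_left (by linarith) (hK0 z)
      have h4 := mul_le_mul_of_nonneg_left h1 (hK0 z)
      exact max_eq_right (by linarith)
    let h : ℕ → C_c(X, ℝ) := fun n =>
      { toFun := fun z => max (g.1 z - 2 * K * (T n).1 z) 0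
        continuous_toFun := (hgc.sub ((T n).2.1.const_mul _)).max continuous_const
        hasCompactSupport' := hcs n }
    have hh : ∀ n z, h n z = max (g.1 z - 2 * K * (T n).1 z) 0 := fun n z => rfl
    have hT0 : ∀ n z, 0 ≤ (T n).1 z := fun n z => by rw [hT]; exact le_max_right _ _
    have hle : ∀ n z, h n z ≤ g.1 z := fun n z => by
      rw [hh]
      exact max_le (by nlinarith [hT0 n z, hK0 z]) (hg z)
    have hlim1 : Tendsto (fun n => L (j (h n))) atTop (𝓝 (L g)) := by
      have hlow : ∀ n, L g - 2 * K * L (T n) ≤ L (j (h n)) := fun n => by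
        have := hLmono (g - (2 * K) • T n) (j (h n)) fun z => le_max_left _ _
        rwa [map_sub, map_smul, smul_eq_mul] at this
      refine tendsto_of_tendsto_of_tendsto_of_le_of_le ?_ tendsto_const_nhds hlow
        fun n => hLmono _ _ (hle n)
      simpa using (tendsto_const_nhds (x := L g)).sub (hTlim.const_mul (2 * K))
    have hint : ∀ n, ∫⁻ z, ENNReal.ofReal (h n z) ∂π = ENNReal.ofReal (L (j (h n))) := fun n => by
      rw [← hΛ, ofReal_integral_eq_lintegral_ofReal]
      · exact (h n).continuous.integrable_of_hasCompactSupport (h n).hasCompactSupport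
      · exact Eventually.of_forall fun z => le_max_right _ _
    have hlim2 : Tendsto (fun n => ∫⁻ z, ENNReal.ofReal (h n z) ∂π) atTop
        (𝓝 (∫⁻ z, ENNReal.ofReal (g.1 z) ∂π)) := by
      refine lintegral_tendsto_of_tendsto_of_monotone
        (fun n => ((h n).continuous.measurable.ennreal_ofReal).aemeasurable)
        (Eventually.of_forall fun z => ?_) (Eventually.of_forall fun z => ?_)
      · intro m n hmn
        refine ENNReal.ofReal_le_ofReal ?_
        rw [hh, hh]
        refine max_le_max ?_ le_rfl
        have : (T n).1 z ≤ (T m).1 z := by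
          rw [hT, hT]
          refine max_le_max ?_ le_rfl
          have : (m : ℝ) ≤ n := by exact_mod_cast hmn
          linarith
        nlinarith [hK0 z]
      · refine ENNReal.tendsto_ofReal (tendsto_const_nhds.congr' ?_)
        obtain ⟨N, hN⟩ := exists_nat_ge (W z)
        filter_upwards [eventually_ge_atTop N] with n hn
        have hNn : (N : ℝ) ≤ n := by exact_mod_cast hn
        rw [hh, hT, max_eq_right (by linarith : W z - n ≤ 0)]
        simp [hg z]
    simp only [hint] at hlim2
    exact tendsto_nhds_unique hlim2 (ENNReal.tendsto_ofReal hlim1)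
  have key' : ∀ g : growthSubmodule W, (∀ z, 0 ≤ g.1 z) →
      Integrable g.1 π ∧ ∫ z, g.1 z ∂π = L g := by
    intro g hg
    have hnn : 0 ≤ᵐ[π] g.1 := Eventually.of_forall hg
    have hm : AEStronglyMeasurable g.1 π := g.2.1.measurable.aestronglyMeasurable
    refine ⟨⟨hm, ?_⟩, ?_⟩
    · rw [hasFiniteIntegral_iff_ofReal hnn, key g hg]
      exact ENNReal.ofReal_lt_top
    · rw [integral_eq_lintegral_of_nonneg_ae hnn hm, key g hg, ENNReal.toReal_ofReal (hL g hg)]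
  refine ⟨π, fun g => ?_⟩
  obtain ⟨hgc, K, hK⟩ := g.2
  let p : growthSubmodule W := ⟨fun z => max (g.1 z) 0, hgc.max continuous_const, K, fun z => by
    rw [abs_of_nonneg (le_max_right _ _)]
    exact (max_le (le_abs_self _) (abs_nonneg _)).trans (hK z)⟩
  let q : growthSubmodule W := ⟨fun z => max (-g.1 z) 0, hgc.neg.max continuous_const, K,
    fun z => by
      rw [abs_of_nonneg (le_max_right _ _)]
      exact (max_le (neg_le_abs _) (abs_nonneg _)).trans (hK z)⟩
  have hpq : g = p - q := by
    ext z
    exact (max_zero_sub_max_neg_zero_eq_self (g.1 z)).symm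
  obtain ⟨hp1, hp2⟩ := key' p fun z => le_max_right _ _
  obtain ⟨hq1, hq2⟩ := key' q fun z => le_max_right _ _
  rw [hpq, map_sub, ← hp2, ← hq2]
  exact ⟨hp1.sub hq1, integral_sub hp1 hq1⟩

theorem ConvexOn.continuous_of_univ {d : ℕ} {f : Rd d → ℝ} (hf : ConvexOn ℝ univ f) :
    Continuous f :=
  continuousOn_univ.1 (hf.continuousOn isOpen_univ)

theorem ConvexOn.exists_linear_lower_bound {d : ℕ} {f : Rd d → ℝ} (hf : ConvexOn ℝ univ f) :
    ∃ C : ℝ, ∀ y, -(C * (1 + ‖y‖)) ≤ f y := by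
  obtain ⟨M, hM⟩ := (isCompact_closedBall (0 : Rd d) 1).exists_bound_of_continuousOn
    hf.continuous_of_univ.continuousOn
  refine ⟨3 * M, fun y => ?_⟩
  have hr := norm_nonneg y
  set r := ‖y‖ with hrdef
  set p : Rd d := (-(1 / (1 + r))) • y with hp
  have hpn : p ∈ Metric.closedBall (0 : Rd d) 1 := by
    rw [mem_closedBall_zero_iff, hp, norm_smul, norm_neg, Real.norm_of_nonneg (by positivity),
      ← hrdef, div_mul_eq_mul_div, one_mul, div_le_one (by positivity)]
    linarith
  have h0 := hM 0 (by simp)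
  have h1 := hM p hpn
  have hsum : (1 + r) / (2 + r) + 1 / (2 + r) = 1 := by
    rw [← add_div, div_eq_one_iff_eq (by positivity)]; ring
  have hc := hf.2 (mem_univ p) (mem_univ y) (by positivity : 0 ≤ (1 + r) / (2 + r))
    (by positivity : 0 ≤ 1 / (2 + r)) hsum
  have hz : ((1 + r) / (2 + r)) • p + (1 / (2 + r)) • y = 0 := by
    rw [hp, smul_smul, ← add_smul]
    have : (1 + r) / (2 + r) * -(1 / (1 + r)) + 1 / (2 + r) = 0 := by field_simp; ring
    rw [this, zero_smul]
  rw [hz, smul_eq_mul, smul_eq_mul] at hc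
  have hc2 : (2 + r) * f 0 ≤ (1 + r) * f p + f y := by
    have := mul_le_mul_of_nonneg_left hc (by positivity : 0 ≤ 2 + r)
    have e : (2 + r) * ((1 + r) / (2 + r) * f p + 1 / (2 + r) * f y) = (1 + r) * f p + f y := by
      field_simp
    linarith
  have h0' := (abs_le.1 h0).1
  have h1' := (abs_le.1 h1).2
  have hM0 : 0 ≤ M := (norm_nonneg _).trans h0
  nlinarith

theorem erealToENN_coe (r : ℝ) : erealToENN (r : EReal) = ENNReal.ofReal r := by
  simp [erealToENN]

theorem erealToENN_neg_coe (r : ℝ) : erealToENN (-(r : EReal)) = ENNReal.ofReal (-r) := by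
  rw [← EReal.coe_neg, erealToENN_coe]

theorem eInt_coe_eq_integral {α : Type*} [MeasurableSpace α] {ρ : Measure α} {f : α → ℝ}
    (hf : Integrable f ρ) : eInt ρ (fun y => (f y : EReal)) = ((∫ y, f y ∂ρ : ℝ) : EReal) := by
  have h1 : ∫⁻ y, ENNReal.ofReal (f y) ∂ρ ≠ ⊤ :=
    ((lintegral_mono fun _ => Real.ofReal_le_enorm _).trans_lt hf.2).ne
  have h2 : ∫⁻ y, ENNReal.ofReal (-f y) ∂ρ ≠ ⊤ :=
    ((lintegral_mono fun _ => Real.ofReal_le_enorm _).trans_lt hf.neg.2).ne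
  simp only [eInt, erealToENN_coe, erealToENN_neg_coe]
  rw [integral_eq_lintegral_pos_part_sub_lintegral_neg_part hf, EReal.coe_sub]
  lift (∫⁻ y, ENNReal.ofReal (f y) ∂ρ) to NNReal using h1 with p
  lift (∫⁻ y, ENNReal.ofReal (-f y) ∂ρ) to NNReal using h2 with q
  rfl

theorem eInt_coe_eq_top {α : Type*} [MeasurableSpace α] {ρ : Measure α} {f g : α → ℝ}
    (hf : AEStronglyMeasurable f ρ) (hg : Integrable g ρ) (hgf : ∀ y, g y ≤ f y)
    (hfi : ¬ Integrable f ρ) : eInt ρ (fun y => (f y : EReal)) = ⊤ := by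
  have h2 : ∫⁻ y, ENNReal.ofReal (-f y) ∂ρ < ⊤ := by
    refine (lintegral_mono fun y => ?_).trans_lt hg.neg.2
    exact (ENNReal.ofReal_le_ofReal (neg_le_neg (hgf y))).trans (Real.ofReal_le_enorm _)
  have h1 : ∫⁻ y, ENNReal.ofReal (f y) ∂ρ = ⊤ := by
    by_contra h1
    refine hfi ⟨hf, ?_⟩
    have : ∀ y, ‖f y‖ₑ ≤ ENNReal.ofReal (f y) + ENNReal.ofReal (-f y) := fun y => by
      rw [← ofReal_norm, Real.norm_eq_abs]
      rcases le_total 0 (f y) with h | h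
      · rw [abs_of_nonneg h]; exact le_self_add
      · rw [abs_of_nonpos h]; exact le_add_self
    refine (lintegral_mono this).trans_lt ?_
    rw [lintegral_add_left' hf.aemeasurable.ennreal_ofReal]
    exact ENNReal.add_lt_top.2 ⟨Ne.lt_top h1, h2⟩
  simp only [eInt, erealToENN_coe, erealToENN_neg_coe, h1, EReal.coe_ennreal_top]
  exact EReal.top_sub (mt EReal.coe_ennreal_eq_top_iff.1 h2.ne)

theorem HasMomentP.integrable_norm {d : ℕ} {ρ : Measure (Rd d)} (h : HasMomentP 1 ρ) :
    Integrable (fun y => ‖y‖) ρ := by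
  refine ⟨continuous_norm.aestronglyMeasurable, ?_⟩
  rw [hasFiniteIntegral_iff_ofReal (Eventually.of_forall fun y => norm_nonneg y)]
  simpa [HasMomentP, lt_top_iff_ne_top] using h

/-- The dual inequality behind the existence of a submartingale coupling. -/
theorem IcxOrder.integral_add_nonneg {d : ℕ} {μ ν : Measure (Rd d)} [IsProbabilityMeasure μ]
    [IsProbabilityMeasure ν] (hμ1 : HasMomentP 1 μ) (hν1 : HasMomentP 1 ν) (h : IcxOrder μ ν)
    {a b : Rd d → ℝ} (ha : Integrable a μ) (hb : Integrable b ν) {K : ℝ}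
    (hbK : ∀ y, b y ≤ K * (1 + ‖y‖)) {φ : Fin d → Rd d → ℝ} (hφ : ∀ i x, 0 ≤ φ i x)
    (hab : ∀ x y, ∑ i, φ i x * (y i - x i) ≤ a x + b y) :
    0 ≤ ∫ x, a x ∂μ + ∫ y, b y ∂ν := by
  let u : Rd d → ℝ := fun y => ⨆ x, (∑ i, φ i x * (y i - x i) - a x)
  have hbdd : ∀ y : Rd d, BddAbove (range fun x : Rd d => ∑ i, φ i x * (y i - x i) - a x) := fun y =>
    ⟨b y, by rintro _ ⟨x, rfl⟩; simp only; linarith [hab x y]⟩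
  have hle : ∀ x y : Rd d, ∑ i, φ i x * (y i - x i) - a x ≤ u y := fun x y => le_ciSup (hbdd y) x
  have hub : ∀ y, u y ≤ b y := fun y => ciSup_le fun x => by linarith [hab x y]
  have hua : ∀ x, -a x ≤ u x := fun x => by simpa using hle x x
  have hconv : ConvexOn ℝ univ u := by
    refine ⟨convex_univ, fun y _ z _ s t hs ht hst => ciSup_le fun x => ?_⟩
    have e : ∑ i, φ i x * ((s • y + t • z) i - x i) - a x =
        s * (∑ i, φ i x * (y i - x i) - a x) + t * (∑ i, φ i x * (z i - x i) - a x) := by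
      have e1 : ∀ i, φ i x * ((s • y + t • z) i - x i) =
          s * (φ i x * (y i - x i)) + t * (φ i x * (z i - x i)) := fun i => by
        simp only [PiLp.add_apply, PiLp.smul_apply, smul_eq_mul]
        linear_combination (-(φ i x * x i)) * (-hst)
      simp only [e1, Finset.sum_add_distrib, ← Finset.mul_sum]
      linear_combination (-a x) * (-hst)
    rw [e, smul_eq_mul, smul_eq_mul]
    exact add_le_add (mul_le_mul_of_nonneg_left (hle x y) hs)
      (mul_le_mul_of_nonneg_left (hle x z) ht)
  have hmono : CoordMono u := fun y z hyz => ciSup_le fun x => by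
    refine le_trans ?_ (hle x z)
    gcongr with i
    · exact hφ i x
    · exact hyz i
  obtain ⟨C, hC⟩ := hconv.exists_linear_lower_bound
  have hint : ∀ ρ : Measure (Rd d), IsProbabilityMeasure ρ → HasMomentP 1 ρ →
      Integrable u ρ := fun ρ _ hρ => by
    refine ((((integrable_const (1 : ℝ)).add hρ.integrable_norm).const_mul (|C| + |K|))).mono'
      hconv.continuous_of_univ.aestronglyMeasurable (Eventually.of_forall fun y => ?_)
    have h1 := (hub y).trans (hbK y)
    have h2 := hC y
    simp only [Pi.add_apply, Real.norm_eq_abs]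
    have h3 := norm_nonneg y
    rw [abs_le]
    constructor
    · nlinarith [le_abs_self C, abs_nonneg K]
    · nlinarith [le_abs_self K, abs_nonneg C]
  have huμ := hint μ inferInstance hμ1
  have huν := hint ν inferInstance hν1
  have hmain := h u hconv hmono
  rw [eInt_coe_eq_integral huμ, eInt_coe_eq_integral huν, EReal.coe_le_coe_iff] at hmain
  have h1 := integral_mono ha.neg huμ hua
  have h2 := integral_mono huν hb hub
  rw [integral_neg'] at h1
  linarith

/-- The weight `1 + ‖x‖ + ‖y‖` on `ℝ^d × ℝ^d`. -/
noncomputable def pairWeight (d : ℕ) (z : Rd d × Rd d) : ℝ := 1 + ‖z.1‖ + ‖z.2‖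

theorem continuous_pairWeight (d : ℕ) : Continuous (pairWeight d) := by
  unfold pairWeight; fun_prop

theorem one_le_pairWeight {d : ℕ} (z : Rd d × Rd d) : 1 ≤ pairWeight d z := by
  have h1 := norm_nonneg z.1
  have h2 := norm_nonneg z.2
  unfold pairWeight
  linarith

theorem isCompact_pairWeight_le (d : ℕ) (c : ℝ) : IsCompact {z | pairWeight d z ≤ c} := by
  refine (isCompact_closedBall (0 : Rd d × Rd d) c).of_isClosed_subset
    (isClosed_le (continuous_pairWeight d) continuous_const) fun z hz => ?_
  have h1 := norm_nonneg z.1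
  have h2 := norm_nonneg z.2
  have hz' : 1 + ‖z.1‖ + ‖z.2‖ ≤ c := hz
  rw [mem_closedBall_zero_iff, Prod.norm_def]
  exact max_le (by linarith) (by linarith)

/-- Continuous functions on `ℝ^d` of at most linear growth. -/
noncomputable abbrev linearGrowth (d : ℕ) : Submodule ℝ (Rd d → ℝ) := growthSubmodule fun x => 1 + ‖x‖

theorem integrable_of_linearGrowth {d : ℕ} {ρ : Measure (Rd d)} [IsProbabilityMeasure ρ]
    (hρ : HasMomentP 1 ρ) {a : Rd d → ℝ} (ha : a ∈ linearGrowth d) : Integrable a ρ := by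
  obtain ⟨hac, K, hK⟩ := ha
  exact (((integrable_const (1 : ℝ)).add hρ.integrable_norm).const_mul K).mono'
    hac.aestronglyMeasurable (Eventually.of_forall hK)

theorem comp_fst_mem_growthSubmodule {d : ℕ} {a : Rd d → ℝ} (ha : a ∈ linearGrowth d) :
    (fun z : Rd d × Rd d => a z.1) ∈ growthSubmodule (pairWeight d) := by
  obtain ⟨hac, K, hK⟩ := ha
  refine ⟨hac.comp continuous_fst, |K|, fun z => (hK z.1).trans ?_⟩
  have h1 := norm_nonneg z.1
  have h2 := norm_nonneg z.2
  unfold pairWeight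
  nlinarith [le_abs_self K, abs_nonneg K]

theorem comp_snd_mem_growthSubmodule {d : ℕ} {b : Rd d → ℝ} (hb : b ∈ linearGrowth d) :
    (fun z : Rd d × Rd d => b z.2) ∈ growthSubmodule (pairWeight d) := by
  obtain ⟨hbc, K, hK⟩ := hb
  refine ⟨hbc.comp continuous_snd, |K|, fun z => (hK z.2).trans ?_⟩
  have h1 := norm_nonneg z.1
  have h2 := norm_nonneg z.2
  unfold pairWeight
  nlinarith [le_abs_self K, abs_nonneg K]

theorem boundedContinuous_mem_linearGrowth {d : ℕ} (f : BoundedContinuousFunction (Rd d) ℝ) :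
    (f : Rd d → ℝ) ∈ linearGrowth d := by
  refine ⟨f.continuous, ‖f‖, fun x => (f.norm_coe_le_norm x).trans ?_⟩
  have h1 := norm_nonneg x
  have h2 := norm_nonneg f
  nlinarith

theorem apply_mem_linearGrowth {d : ℕ} (i : Fin d) : (fun x : Rd d => x i) ∈ linearGrowth d := by
  refine ⟨by fun_prop, 1, fun x => ?_⟩
  have := PiLp.norm_apply_le x i
  rw [Real.norm_eq_abs] at this
  linarith

theorem max_mem_linearGrowth {d : ℕ} (c k : ℝ) :
    (fun x : Rd d => max (1 + c * ‖x‖ - k) 0) ∈ linearGrowth d := by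
  refine ⟨by fun_prop, 1 + |c| + |k|, fun x => ?_⟩
  have h1 := norm_nonneg x
  rw [abs_of_nonneg (le_max_right _ _)]
  refine max_le ?_ (by positivity)
  nlinarith [le_abs_self c, neg_abs_le k, abs_nonneg c, abs_nonneg k]

theorem tendsto_integral_max_linear {d : ℕ} {ρ : Measure (Rd d)} [IsProbabilityMeasure ρ]
    (hρ : HasMomentP 1 ρ) :
    Tendsto (fun n : ℕ => ∫ x, max (1 + 2 * ‖x‖ - n) 0 ∂ρ) atTop (𝓝 0) := by
  suffices h : Tendsto (fun n : ℕ => ∫ x, max (1 + 2 * ‖x‖ - n) 0 ∂ρ) atTop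
      (𝓝 (∫ _, (0 : ℝ) ∂ρ)) by rwa [integral_zero] at h
  refine tendsto_integral_of_dominated_convergence (fun x => 1 + 2 * ‖x‖)
    (fun n => (integrable_of_linearGrowth hρ (max_mem_linearGrowth 2 n)).1)
    ((integrable_const _).add (hρ.integrable_norm.const_mul 2))
    (fun n => Eventually.of_forall fun x => ?_) (Eventually.of_forall fun x => ?_)
  · rw [Real.norm_of_nonneg (le_max_right _ _)]
    exact max_le (by linarith [(Nat.cast_nonneg n : (0 : ℝ) ≤ n)]) (by positivity)
  · refine tendsto_const_nhds.congr' ?_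
    obtain ⟨N, hN⟩ := exists_nat_ge (1 + 2 * ‖x‖)
    filter_upwards [eventually_ge_atTop N] with n hn
    have hNn : (N : ℝ) ≤ n := by exact_mod_cast hn
    rw [max_eq_right (by linarith)]

/-- The drift `∑ᵢ φᵢ(x) (yᵢ - xᵢ)`. -/
def drift {d : ℕ} (φ : Fin d → Rd d → ℝ) (z : Rd d × Rd d) : ℝ :=
  ∑ i, φ i z.1 * (z.2 i - z.1 i)

/-- The cone of functions dominating a drift with nonnegative coefficients. -/
def driftCone (d : ℕ) : PointedCone ℝ (growthSubmodule (pairWeight d)) where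
  carrier := {g | ∃ φ : Fin d → Rd d → ℝ, (∀ i x, 0 ≤ φ i x) ∧ ∀ z, drift φ z ≤ g.1 z}
  add_mem' := by
    rintro f g ⟨φ, hφ, hf⟩ ⟨ψ, hψ, hg⟩
    refine ⟨φ + ψ, fun i x => add_nonneg (hφ i x) (hψ i x), fun z => ?_⟩
    have : drift (φ + ψ) z = drift φ z + drift ψ z := by
      simp [drift, add_mul, Finset.sum_add_distrib]
    rw [this]
    exact add_le_add (hf z) (hg z)
  zero_mem' := ⟨0, fun _ _ => le_rfl, fun z => by simp [drift]⟩
  smul_mem' := by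
    rintro ⟨c, hc⟩ f ⟨φ, hφ, hf⟩
    refine ⟨c • φ, fun i x => mul_nonneg hc (hφ i x), fun z => ?_⟩
    have : drift (c • φ) z = c * drift φ z := by
      simp [drift, Finset.mul_sum, mul_assoc]
    rw [this]
    exact mul_le_mul_of_nonneg_left (hf z) hc

/-- Functions of the form `a(x) + b(y)`. -/
def separated (d : ℕ) : Submodule ℝ (growthSubmodule (pairWeight d)) where
  carrier := {g | ∃ a ∈ linearGrowth d, ∃ b ∈ linearGrowth d, ∀ z, g.1 z = a z.1 + b z.2}
  add_mem' := by
    rintro f g ⟨a, ha, b, hb, hf⟩ ⟨a', ha', b', hb', hg⟩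
    refine ⟨a + a', add_mem ha ha', b + b', add_mem hb hb', fun z => ?_⟩
    change f.1 z + g.1 z = _
    rw [hf, hg, Pi.add_apply, Pi.add_apply]
    ring
  zero_mem' := ⟨0, zero_mem _, 0, zero_mem _, fun z => by simp⟩
  smul_mem' := by
    rintro c f ⟨a, ha, b, hb, hf⟩
    refine ⟨c • a, Submodule.smul_mem _ c ha, c • b, Submodule.smul_mem _ c hb, fun z => ?_⟩
    change c * f.1 z = _
    rw [hf, Pi.smul_apply, Pi.smul_apply, smul_eq_mul, smul_eq_mul]
    ring

/-- Under the increasing convex order there is a functional with marginals `μ` and `ν` which is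
nonnegative on the drift cone. -/
theorem IcxOrder.exists_functional {d : ℕ} {μ ν : Measure (Rd d)} [IsProbabilityMeasure μ]
    [IsProbabilityMeasure ν] (hμ1 : HasMomentP 1 μ) (hν1 : HasMomentP 1 ν) (h : IcxOrder μ ν) :
    ∃ L : growthSubmodule (pairWeight d) →ₗ[ℝ] ℝ, (∀ g ∈ driftCone d, 0 ≤ L g) ∧
      ∀ g : growthSubmodule (pairWeight d), ∀ a ∈ linearGrowth d, ∀ b ∈ linearGrowth d,
        (∀ z, g.1 z = a z.1 + b z.2) → L g = ∫ x, a x ∂μ + ∫ y, b y ∂ν := by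
  have hfst : ∀ a ∈ linearGrowth d, Integrable (fun z : Rd d × Rd d => a z.1) (μ.prod ν) :=
    fun a ha => (integrable_of_linearGrowth hμ1 ha).comp_fst ν
  have hsnd : ∀ b ∈ linearGrowth d, Integrable (fun z : Rd d × Rd d => b z.2) (μ.prod ν) :=
    fun b hb => (integrable_of_linearGrowth hν1 hb).comp_snd μ
  have hsep : ∀ g : growthSubmodule (pairWeight d), g ∈ separated d →
      Integrable g.1 (μ.prod ν) := by
    rintro g ⟨a, ha, b, hb, hg⟩
    rw [funext hg]
    exact (hfst a ha).add (hsnd b hb)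
  let f : growthSubmodule (pairWeight d) →ₗ.[ℝ] ℝ :=
    { domain := separated d
      toFun :=
        { toFun := fun g => ∫ z, g.1.1 z ∂(μ.prod ν)
          map_add' := fun g g' => integral_add (hsep _ g.2) (hsep _ g'.2)
          map_smul' := fun c g => integral_const_mul c _ } }
  have hf : ∀ g : f.domain, ∀ a ∈ linearGrowth d, ∀ b ∈ linearGrowth d,
      (∀ z, g.1.1 z = a z.1 + b z.2) → f g = ∫ x, a x ∂μ + ∫ y, b y ∂ν := by
    intro g a ha b hb hg
    change ∫ z, g.1.1 z ∂(μ.prod ν) = _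
    rw [funext hg, integral_add (hfst a ha) (hsnd b hb)]
    congr 1
    · simpa using integral_fun_fst (μ := μ) (ν := ν) a
    · simpa using integral_fun_snd (μ := μ) (ν := ν) b
  have hnonneg : ∀ x : f.domain, (x : growthSubmodule (pairWeight d)) ∈ driftCone d → 0 ≤ f x := by
    rintro ⟨g, a, ha, b, hb, hg⟩ ⟨φ, hφ, hφg⟩
    rw [hf _ a ha b hb hg]
    obtain ⟨-, K, hK⟩ := id hb
    refine h.integral_add_nonneg hμ1 hν1 (integrable_of_linearGrowth hμ1 ha)
      (integrable_of_linearGrowth hν1 hb) (fun y => (le_abs_self _).trans (hK y)) hφ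
      fun x y => ?_
    have := hφg (x, y)
    rwa [hg] at this
  have hdense : ∀ g, ∃ x : f.domain, (x : growthSubmodule (pairWeight d)) + g ∈ driftCone d := by
    intro g
    obtain ⟨-, K, hK⟩ := g.2
    have ha : (fun x : Rd d => K * (1 + ‖x‖)) ∈ linearGrowth d := by
      refine ⟨by fun_prop, |K|, fun x => ?_⟩
      rw [abs_mul, abs_of_nonneg (by positivity : 0 ≤ 1 + ‖x‖)]
    have hb : (fun x : Rd d => K * ‖x‖) ∈ linearGrowth d := by
      refine ⟨by fun_prop, |K|, fun x => ?_⟩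
      rw [abs_mul, abs_norm]
      exact mul_le_mul_of_nonneg_left (by linarith) (abs_nonneg K)
    let k : growthSubmodule (pairWeight d) :=
      ⟨fun z => K * (1 + ‖z.1‖) + K * ‖z.2‖,
        add_mem (comp_fst_mem_growthSubmodule ha) (comp_snd_mem_growthSubmodule hb)⟩
    refine ⟨⟨k, _, ha, _, hb, fun z => rfl⟩, 0, fun _ _ => le_rfl, fun z => ?_⟩
    have h1 := (abs_le.1 (hK z)).1
    have h2 : drift (0 : Fin d → Rd d → ℝ) z = 0 := by simp [drift]
    rw [h2]
    change 0 ≤ K * (1 + ‖z.1‖) + K * ‖z.2‖ + g.1 z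
    unfold pairWeight at h1
    linarith
  obtain ⟨L, hLf, hL⟩ := riesz_extension (driftCone d) f hnonneg hdense
  refine ⟨L, hL, fun g a ha b hb hg => ?_⟩
  have hgs : g ∈ separated d := ⟨a, ha, b, hb, hg⟩
  rw [← hf ⟨g, hgs⟩ a ha b hb hg]
  exact hLf ⟨g, hgs⟩

/-- Under the increasing convex order there is a coupling with nonnegative drift against
bounded continuous test functions. -/
theorem IcxOrder.exists_coupling_drift_nonneg {d : ℕ} {μ ν : Measure (Rd d)}
    [IsProbabilityMeasure μ] [IsProbabilityMeasure ν] (hμ1 : HasMomentP 1 μ)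
    (hν1 : HasMomentP 1 ν) (h : IcxOrder μ ν) :
    ∃ π : Measure (Rd d × Rd d), IsCoupling π μ ν ∧
      ∀ (φ : BoundedContinuousFunction (Rd d) ℝ) (i : Fin d), (∀ x, 0 ≤ φ x) →
        0 ≤ ∫ z, φ z.1 * (z.2 i - z.1 i) ∂π := by
  obtain ⟨L, hL, hLsep⟩ := h.exists_functional hμ1 hν1
  have hLpos : ∀ g : growthSubmodule (pairWeight d), (∀ z, 0 ≤ g.1 z) → 0 ≤ L g :=
    fun g hg => hL g ⟨0, fun _ _ => le_rfl, fun z => by simpa [drift] using hg z⟩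
  let T : ℕ → growthSubmodule (pairWeight d) := fun n =>
    ⟨fun z => max (pairWeight d z - n) 0,
      ((continuous_pairWeight d).sub continuous_const).max continuous_const, 1, fun z => by
        have := one_le_pairWeight z
        have hn : (0 : ℝ) ≤ n := Nat.cast_nonneg n
        rw [abs_of_nonneg (le_max_right _ _)]
        exact max_le (by linarith) (by linarith)⟩
  have hTlim : Tendsto (fun n => L (T n)) atTop (𝓝 0) := by
    have hlim := (tendsto_integral_max_linear hμ1).add (tendsto_integral_max_linear hν1)
    rw [add_zero] at hlim
    refine squeeze_zero (fun n => hLpos _ fun z => le_max_right _ _) (fun n => ?_) hlim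
    let S : growthSubmodule (pairWeight d) :=
      ⟨fun z => max (1 + 2 * ‖z.1‖ - n) 0 + max (1 + 2 * ‖z.2‖ - n) 0,
        add_mem (comp_fst_mem_growthSubmodule (max_mem_linearGrowth 2 n))
          (comp_snd_mem_growthSubmodule (max_mem_linearGrowth 2 n))⟩
    rw [← hLsep S _ (max_mem_linearGrowth 2 n) _ (max_mem_linearGrowth 2 n) fun z => rfl]
    have hS := hLpos (S - T n) fun z => by
      change 0 ≤ max (1 + 2 * ‖z.1‖ - n) 0 + max (1 + 2 * ‖z.2‖ - n) 0 -
        max (1 + ‖z.1‖ + ‖z.2‖ - n) 0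
      have h1 := le_max_left (1 + 2 * ‖z.1‖ - n) 0
      have h2 := le_max_left (1 + 2 * ‖z.2‖ - n) 0
      have h3 := le_max_right (1 + 2 * ‖z.1‖ - n) 0
      have h4 := le_max_right (1 + 2 * ‖z.2‖ - n) 0
      rw [sub_nonneg]
      refine max_le ?_ (by linarith)
      rcases le_total ‖z.1‖ ‖z.2‖ with h | h <;> linarith
    rw [map_sub] at hS
    linarith
  obtain ⟨π, hπ⟩ := exists_measure_of_tight_positive_functional one_le_pairWeight
    (isCompact_pairWeight_le d) L hLpos T (fun n z => rfl) hTlim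
  have hfst : ∀ a (_ : a ∈ linearGrowth d), ∫ z, a z.1 ∂π = ∫ x, a x ∂μ := fun a ha => by
    rw [(hπ ⟨_, comp_fst_mem_growthSubmodule ha⟩).2,
      hLsep _ a ha 0 (zero_mem _) fun z => (add_zero _).symm]
    simp
  have hsnd : ∀ b (hb : b ∈ linearGrowth d), ∫ z, b z.2 ∂π = ∫ y, b y ∂ν := fun b hb => by
    rw [(hπ ⟨_, comp_snd_mem_growthSubmodule hb⟩).2,
      hLsep _ 0 (zero_mem _) b hb fun z => (zero_add _).symm]
    simp
  have h1mem : (fun _ : Rd d => (1 : ℝ)) ∈ linearGrowth d :=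
    ⟨continuous_const, 1, fun x => by simp⟩
  have : IsFiniteMeasure π :=
    (integrable_const_iff_isFiniteMeasure one_ne_zero).1
      (hπ ⟨_, comp_fst_mem_growthSubmodule h1mem⟩).1
  have hπ1 : π.map Prod.fst = μ := by
    refine ext_of_forall_integral_eq_of_IsFiniteMeasure fun f => ?_
    rw [integral_map measurable_fst.aemeasurable f.continuous.aestronglyMeasurable]
    exact hfst f (boundedContinuous_mem_linearGrowth f)
  have hπ2 : π.map Prod.snd = ν := by
    refine ext_of_forall_integral_eq_of_IsFiniteMeasure fun f => ?_
    rw [integral_map measurable_snd.aemeasurable f.continuous.aestronglyMeasurable]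
    exact hsnd f (boundedContinuous_mem_linearGrowth f)
  refine ⟨π, ⟨⟨?_⟩, hπ1, hπ2⟩, fun φ i hφ => ?_⟩
  · rw [← preimage_univ (f := (Prod.fst : Rd d × Rd d → Rd d)),
      ← Measure.map_apply measurable_fst MeasurableSet.univ, hπ1, measure_univ]
  · have hmem : (fun z : Rd d × Rd d => φ z.1 * (z.2 i - z.1 i)) ∈
        growthSubmodule (pairWeight d) := by
      have hsub := sub_mem (comp_snd_mem_growthSubmodule (apply_mem_linearGrowth i))
        (comp_fst_mem_growthSubmodule (apply_mem_linearGrowth i))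
      obtain ⟨hc, K, hK⟩ := hsub
      refine ⟨(φ.continuous.comp continuous_fst).mul hc, ‖φ‖ * K, fun z => ?_⟩
      rw [abs_mul, mul_assoc]
      exact mul_le_mul (φ.norm_coe_le_norm _) (hK z) (abs_nonneg _) (norm_nonneg _)
    rw [(hπ ⟨_, hmem⟩).2]
    refine hL _ ⟨Pi.single i φ, fun j x => ?_, fun z => le_of_eq ?_⟩
    · by_cases hji : j = i
      · subst hji; simpa using hφ x
      · simp [Pi.single_eq_of_ne hji]
    · unfold drift
      rw [Finset.sum_eq_single i (fun j _ hji => by simp [Pi.single_eq_of_ne hji]) (by simp)]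
      simp

/-- An integrable function with nonnegative integral over every closed set is a.e. nonnegative. -/
theorem ae_nonneg_of_forall_setIntegral_isClosed_nonneg {X : Type*} [TopologicalSpace X]
    [MeasurableSpace X] [BorelSpace X] {μ : Measure X} [IsFiniteMeasure μ] [μ.WeaklyRegular]
    {h : X → ℝ} (hh : Integrable h μ) (hF : ∀ F, IsClosed F → 0 ≤ ∫ x in F, h x ∂μ) :
    0 ≤ᵐ[μ] h := by
  obtain ⟨h', hm, hae⟩ := hh.1
  refine EventuallyLE.trans_eq ?_ hae.symm
  have hS : MeasurableSet {x | h' x < 0} := measurableSet_lt hm.measurable measurable_const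
  suffices h0 : μ {x | h' x < 0} = 0 by
    rw [EventuallyLE, ae_iff]
    simpa using h0
  by_contra h0
  obtain ⟨F, hFS, hFc, hFpos⟩ :=
    hS.exists_lt_isClosed_of_ne_top (measure_ne_top _ _) (pos_iff_ne_zero.2 h0)
  have hle := hF F hFc
  rw [integral_congr_ae (ae_restrict_of_ae hae)] at hle
  have hint : IntegrableOn (fun x => -h' x) F μ := ((hh.congr hae).neg).integrableOn
  have hneg : ∀ x ∈ F, h' x < 0 := fun x hx => hFS hx
  have hpos : 0 < ∫ x in F, -h' x ∂μ := by
    rw [setIntegral_pos_iff_support_of_nonneg_ae _ hint]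
    · refine hFpos.trans_le (measure_mono fun x hx => ⟨?_, hx⟩)
      exact (neg_pos.2 (hneg x hx)).ne'
    · filter_upwards [ae_restrict_mem hFc.measurableSet] with x hx
      exact (neg_pos.2 (hneg x hx)).le
  rw [integral_neg] at hpos
  linarith

section Coupling

variable {d : ℕ} {μ ν : Measure (Rd d)} {π : Measure (Rd d × Rd d)}

theorem IsCoupling.integrable_comp_fst {E : Type*} [NormedAddCommGroup E] (hπ : IsCoupling π μ ν)
    {a : Rd d → E} (ha : Integrable a μ) : Integrable (fun z : Rd d × Rd d => a z.1) π := by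
  obtain ⟨-, h, -⟩ := hπ
  subst h
  exact ha.comp_measurable measurable_fst

theorem IsCoupling.integrable_comp_snd {E : Type*} [NormedAddCommGroup E] (hπ : IsCoupling π μ ν)
    {b : Rd d → E} (hb : Integrable b ν) : Integrable (fun z : Rd d × Rd d => b z.2) π := by
  obtain ⟨-, -, h⟩ := hπ
  subst h
  exact hb.comp_measurable measurable_snd

theorem HasMomentP.integrable_id {ρ : Measure (Rd d)} (h : HasMomentP 1 ρ) :
    Integrable (fun y : Rd d => y) ρ :=
  (integrable_norm_iff aestronglyMeasurable_id).1 h.integrable_norm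

/-- A coupling with nonnegative drift against test functions is a submartingale coupling. -/
theorem IsCoupling.ae_le_integral_disint (hπ : IsCoupling π μ ν) (hμ1 : HasMomentP 1 μ)
    (hν1 : HasMomentP 1 ν)
    (hdrift : ∀ (φ : BoundedContinuousFunction (Rd d) ℝ) (i : Fin d), (∀ x, 0 ≤ φ x) →
      0 ≤ ∫ z, φ z.1 * (z.2 i - z.1 i) ∂π) :
    ∀ᵐ x ∂μ, ∀ i, x i ≤ (∫ y, y ∂(disint π x)) i := by
  have hprob := hπ.1
  have hfst : π.fst = μ := hπ.2.1
  have hμp : IsProbabilityMeasure μ := hfst ▸ inferInstance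
  have hd : disint π = π.condKernel := dif_pos (inferInstance : IsFiniteMeasure π)
  have hyint : Integrable (fun z : Rd d × Rd d => z.2) π :=
    hπ.integrable_comp_snd hν1.integrable_id
  have hxint : Integrable (fun z : Rd d × Rd d => z.1) π :=
    hπ.integrable_comp_fst hμ1.integrable_id
  rw [ae_all_iff]
  intro i
  have hi : Integrable (fun z : Rd d × Rd d => z.2 i - z.1 i) π :=
    ((EuclideanSpace.proj i : Rd d →L[ℝ] ℝ).integrable_comp hyint).sub
      ((EuclideanSpace.proj i : Rd d →L[ℝ] ℝ).integrable_comp hxint)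
  have hclosed : ∀ F, IsClosed F →
      0 ≤ ∫ x in F, ∫ y, (y i - x i) ∂(π.condKernel x) ∂μ := by
    intro F hF
    have hset := Measure.setIntegral_condKernel_univ_right (ρ := π) hF.measurableSet
      hi.integrableOn
    rw [hfst] at hset
    rw [hset, ← integral_indicator (hF.measurableSet.prod MeasurableSet.univ)]
    have hlim : Tendsto (fun n => ∫ z, (hF.apprSeq n z.1 : ℝ) * (z.2 i - z.1 i) ∂π) atTop
        (𝓝 (∫ z, (F ×ˢ univ).indicator (fun z : Rd d × Rd d => z.2 i - z.1 i) z ∂π)) := by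
      refine tendsto_integral_of_dominated_convergence (fun z => ‖z.2 i - z.1 i‖) (fun n => ?_)
        hi.norm (fun n => Eventually.of_forall fun z => ?_) (Eventually.of_forall fun z => ?_)
      · refine AEStronglyMeasurable.mul (Continuous.aestronglyMeasurable ?_) hi.1
        exact NNReal.continuous_coe.comp ((hF.apprSeq n).continuous.comp continuous_fst)
      · rw [norm_mul]
        refine mul_le_of_le_one_left (norm_nonneg _) ?_
        rw [Real.norm_of_nonneg (NNReal.coe_nonneg _)]
        exact_mod_cast HasOuterApproxClosed.apprSeq_apply_le_one hF n z.1
      · have h1 := tendsto_pi_nhds.1 (HasOuterApproxClosed.tendsto_apprSeq hF) z.1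
        have h2 := ((NNReal.tendsto_coe.2 h1).mul_const (z.2 i - z.1 i))
        convert h2 using 2
        by_cases hz : z.1 ∈ F <;> simp [hz]
    refine ge_of_tendsto' hlim fun n => ?_
    let φ : BoundedContinuousFunction (Rd d) ℝ :=
      BoundedContinuousFunction.ofNormedAddCommGroup (fun x => (hF.apprSeq n x : ℝ))
        (NNReal.continuous_coe.comp (hF.apprSeq n).continuous) 1 fun x => by
          rw [Real.norm_of_nonneg (NNReal.coe_nonneg _)]
          exact_mod_cast HasOuterApproxClosed.apprSeq_apply_le_one hF n x
    exact hdrift φ i fun x => NNReal.coe_nonneg _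
  have hint : Integrable (fun x => ∫ y, (y i - x i) ∂(π.condKernel x)) μ :=
    hfst ▸ hi.integral_condKernel
  have hnn := ae_nonneg_of_forall_setIntegral_isClosed_nonneg hint hclosed
  have hy : ∀ᵐ x ∂μ, Integrable (fun y : Rd d => y) (π.condKernel x) :=
    hfst ▸ hyint.condKernel_ae
  filter_upwards [hnn, hy] with x hx hyx
  have hyi : Integrable (fun y : Rd d => y i) (π.condKernel x) :=
    (EuclideanSpace.proj i : Rd d →L[ℝ] ℝ).integrable_comp hyx
  have e : (∫ y, y ∂(π.condKernel x)) i = ∫ y : Rd d, y i ∂(π.condKernel x) :=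
    ((EuclideanSpace.proj i : Rd d →L[ℝ] ℝ).integral_comp_comm hyx).symm
  have hx' : 0 ≤ ∫ y : Rd d, (y i - x i) ∂(π.condKernel x) := hx
  rw [integral_sub hyi (integrable_const _)] at hx'
  rw [hd, e]
  simpa using hx'

/-- A submartingale coupling forces the increasing convex order. -/
theorem IsCoupling.icxOrder (hπ : IsCoupling π μ ν) (hμ1 : HasMomentP 1 μ)
    (hν1 : HasMomentP 1 ν) (hsub : ∀ᵐ x ∂μ, ∀ i, x i ≤ (∫ y, y ∂(disint π x)) i) :
    IcxOrder μ ν := by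
  intro f hf hmono
  have hprob := hπ.1
  have hfst : π.fst = μ := hπ.2.1
  have hsnd : π.snd = ν := hπ.2.2
  have hμp : IsProbabilityMeasure μ := hfst ▸ inferInstance
  have hνp : IsProbabilityMeasure ν := hsnd ▸ inferInstance
  have hd : disint π = π.condKernel := dif_pos (inferInstance : IsFiniteMeasure π)
  rw [hd] at hsub
  have hfc := hf.continuous_of_univ
  obtain ⟨C, hC⟩ := hf.exists_linear_lower_bound
  have hlow : ∀ ρ : Measure (Rd d), IsProbabilityMeasure ρ → HasMomentP 1 ρ →
      Integrable (fun y => -(C * (1 + ‖y‖))) ρ := fun ρ _ hρ =>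
    (((integrable_const (1 : ℝ)).add hρ.integrable_norm).const_mul C).neg
  by_cases hfν : Integrable f ν
  swap
  · rw [eInt_coe_eq_top hfc.aestronglyMeasurable (hlow ν hνp hν1) hC hfν]
    exact le_top
  have hfπ : Integrable (fun z : Rd d × Rd d => f z.2) π := hπ.integrable_comp_snd hfν
  have hyint : Integrable (fun z : Rd d × Rd d => z.2) π :=
    hπ.integrable_comp_snd hν1.integrable_id
  have hy : ∀ᵐ x ∂μ, Integrable (fun y : Rd d => y) (π.condKernel x) :=
    hfst ▸ hyint.condKernel_ae
  have hfy : ∀ᵐ x ∂μ, Integrable f (π.condKernel x) := hfst ▸ hfπ.condKernel_ae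
  have hFint : Integrable (fun x => ∫ y, f y ∂(π.condKernel x)) μ :=
    hfst ▸ hfπ.integral_condKernel
  have hle : ∀ᵐ x ∂μ, f x ≤ ∫ y, f y ∂(π.condKernel x) := by
    filter_upwards [hsub, hy, hfy] with x hx hyx hfx
    exact (hmono _ _ hx).trans (hf.map_integral_le hfc.continuousOn isClosed_univ
      (Eventually.of_forall fun _ => mem_univ _) hyx hfx)
  have hfμ : Integrable f μ :=
    integrable_of_le_of_le hfc.aestronglyMeasurable (Eventually.of_forall hC) hle
      (hlow μ hμp hμ1) hFint
  rw [eInt_coe_eq_integral hfμ, eInt_coe_eq_integral hfν, EReal.coe_le_coe_iff]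
  refine (integral_mono_ae hfμ hFint hle).trans_eq ?_
  have h1 := Measure.integral_condKernel hfπ
  rw [hfst] at h1
  rw [h1, ← hsnd, Measure.snd, integral_map measurable_snd.aemeasurable
    hfc.aestronglyMeasurable]

end Coupling

/-- **Strassen's theorem for submartingales**: for `μ, ν ∈ P₁(ℝ^d)`, `μ ≼_icx ν` if and
only if there is a coupling `π ∈ Π(μ,ν)` with `x ≤ mean(π_x)` coordinatewise for
`μ`-a.e. `x`. -/
theorem strassen_submartingale {d : ℕ} (μ ν : Measure (Rd d))
    (hμ : IsProbabilityMeasure μ) (hν : IsProbabilityMeasure ν)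
    (hμ1 : HasMomentP 1 μ) (hν1 : HasMomentP 1 ν) :
    IcxOrder μ ν ↔
      ∃ π : Measure (Rd d × Rd d), IsCoupling π μ ν ∧
        ∀ᵐ x ∂μ, ∀ i, x i ≤ (∫ y, y ∂(disint π x)) i := by
  refine ⟨fun h => ?_, fun ⟨π, hπ, hsub⟩ => hπ.icxOrder hμ1 hν1 hsub⟩
  obtain ⟨π, hπ, hdrift⟩ := h.exists_coupling_drift_nonneg hμ1 hν1
  exact ⟨π, hπ, hπ.ae_le_integral_disint hμ1 hν1 hdrift⟩
end
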